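/- (Maier, Lemma 1) Fix the definition of a good modulus with respect to a constant c_2 > 0: an integer q > 1 is good if L(s, χ) ≠ 0 for all Dirichlet characters χ mod q and all complex s = σ + it with σ > 1 − c_2/log(q(|t| + 1)). Then there is a constant c_2 > 0 such that, in terms of this c_2, there exist arbitrarily large values of x for which the modulus P(x) = ∏_{p < x, p prime} p is good; i.e., for every X_0 there exists x ≥ X_0 with P(x) a good modulus. -/

import Mathlib

open Real Finset

/-- An integer `q > 1` is a good modulus (with respect to the constant `c₂ > 0`) if
`L(s, χ) ≠ 0` for every Dirichlet character `χ mod q` and every `s = σ + it` with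
`σ > 1 - c₂ / log (q(|t| + 1))`. -/
def IsGoodModulus (c₂ : ℝ) (q : ℕ) (hq : 1 < q) : Prop :=
  haveI : NeZero q := ⟨by omega⟩
  ∀ χ : DirichletCharacter ℂ q, ∀ s : ℂ,
    s.re > 1 - c₂ / Real.log (q * (|s.im| + 1)) →
    DirichletCharacter.LFunction χ s ≠ 0

open Complex Metric in
lemma blaschke_step {f : ℂ → ℂ} {R K : ℝ} (hR : 0 < R) (hf : DiffContOnCl ℂ f (ball 0 R))
    (hK : ∀ z ∈ closedBall (0:ℂ) R, ‖f z‖ ≤ K) (h0 : f 0 ≠ 0) {ρ : ℂ} (hρ : ‖ρ‖ < R)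
    (hz : f ρ = 0) :
    ∃ h : ℂ → ℂ, DiffContOnCl ℂ h (ball 0 R) ∧ (∀ z ∈ closedBall (0:ℂ) R, ‖h z‖ ≤ K) ∧
      ‖h 0‖ = ‖f 0‖ * (R / ‖ρ‖) ∧ h 0 ≠ 0 ∧
      (∀ z, z ≠ ρ → ‖z‖ < R → (h z = 0 ↔ f z = 0)) ∧
      deriv f 0 / f 0 = deriv h 0 / h 0 + (-1 / ρ + (starRingEnd ℂ) ρ / R ^ 2) := by
  have hρ0 : ρ ≠ 0 := by rintro rfl; exact h0 hz
  have hρmem : ball (0:ℂ) R ∈ nhds ρ := isOpen_ball.mem_nhds (by simpa using hρ)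
  have hcl : closure (ball (0:ℂ) R) = closedBall 0 R := closure_ball _ hR.ne'
  set h : ℂ → ℂ := fun z => dslope f ρ z * ((R^2 - (starRingEnd ℂ) ρ * z) / R) with hdef
  have hd : DiffContOnCl ℂ h (ball 0 R) := by
    constructor
    · apply DifferentiableOn.mul
      · exact (Complex.differentiableOn_dslope hρmem).2 hf.1
      · fun_prop
    · apply ContinuousOn.mul
      · refine (continuousOn_dslope ?_).2 ⟨hf.2, ?_⟩
        · exact Filter.mem_of_superset hρmem subset_closure
        · exact hf.1.differentiableAt hρmem
      · fun_prop
  have hfac : ∀ z, z ≠ ρ → h z = f z * ((R^2 - (starRingEnd ℂ) ρ * z) / (R * (z - ρ))) := by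
    intro z hzρ
    have : z - ρ ≠ 0 := sub_ne_zero.2 hzρ
    have hR' : (R:ℂ) ≠ 0 := by exact_mod_cast hR.ne'
    simp only [hdef, dslope_of_ne f hzρ, slope_def_field, hz]
    field_simp
    ring
  have hnum : ∀ z : ℂ, ‖z‖ < R → (R:ℂ)^2 - (starRingEnd ℂ) ρ * z ≠ 0 := by
    intro z hz' h'
    have h2 : (R:ℂ)^2 = (starRingEnd ℂ) ρ * z := by linear_combination h'
    have h3 : R^2 = ‖ρ‖ * ‖z‖ := by
      have := congrArg norm h2
      simpa [abs_of_pos hR] using this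
    nlinarith [norm_nonneg ρ, norm_nonneg z]
  have hsph : ∀ z ∈ sphere (0:ℂ) R, ‖h z‖ ≤ K := by
    intro z hzs
    have hzn : ‖z‖ = R := by simpa using hzs
    have hne : z ≠ ρ := by rintro rfl; linarith
    have h1 := Complex.norm_canonicalFactor_eval_circle_eq_one (w := ρ) (z := z) (R := R)
      (by simpa using hρ) hzs
    rw [Complex.canonicalFactor_apply] at h1
    rw [hfac z hne, norm_mul, h1, mul_one]
    exact hK z (sphere_subset_closedBall hzs)
  have hbd : ∀ z ∈ closedBall (0:ℂ) R, ‖h z‖ ≤ K := by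
    intro z hzc
    refine Complex.norm_le_of_forall_mem_frontier_norm_le (U := ball 0 R) isBounded_ball hd ?_ ?_
    · intro w hw
      rw [frontier_ball _ hR.ne'] at hw
      exact hsph w hw
    · rwa [hcl]
  have hR' : (R:ℂ) ≠ 0 := by exact_mod_cast hR.ne'
  have h00 : h 0 = f 0 * (R / (-ρ)) := by
    rw [hfac 0 hρ0.symm]
    field_simp
    simp
  refine ⟨h, hd, hbd, ?_, ?_, ?_, ?_⟩
  · rw [h00]; simp [abs_of_pos hR]
  · rw [h00]; simp [h0, hρ0, hR']
  · intro z hzρ hzR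
    rw [hfac z hzρ]
    have := hnum z hzR
    have : z - ρ ≠ 0 := sub_ne_zero.2 hzρ
    constructor
    · intro h'
      rcases mul_eq_zero.1 h' with h' | h'
      · exact h'
      · exfalso; simp_all
    · intro h'; simp [h']
  · have hev : h =ᶠ[nhds 0] fun z => f z * ((R^2 - (starRingEnd ℂ) ρ * z) / (R * (z - ρ))) := by
      filter_upwards [isOpen_ne.mem_nhds hρ0.symm] with z hz using hfac z hz
    have hfd : DifferentiableAt ℂ f 0 := hf.1.differentiableAt (isOpen_ball.mem_nhds (by simpa using hR))
    have hd2 : HasDerivAt (fun z => f z * ((R^2 - (starRingEnd ℂ) ρ * z) / (R * (z - ρ))))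
       (deriv f 0 * ((R^2 - (starRingEnd ℂ) ρ * 0) / (R * (0 - ρ))) + f 0 *
        (((-((starRingEnd ℂ) ρ * 1)) * (R * (0 - ρ)) - (R^2 - (starRingEnd ℂ) ρ * 0) * (R * 1)) / (R * (0 - ρ))^2)) 0 := by
      apply HasDerivAt.mul hfd.hasDerivAt
      apply HasDerivAt.div
      · exact ((hasDerivAt_id (0:ℂ)).const_mul _).const_sub _
      · exact ((hasDerivAt_id (0:ℂ)).sub_const _).const_mul _
      · simp [hR', hρ0]
    rw [hev.deriv_eq, hd2.deriv, h00]
    field_simp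
    ring

open Complex Metric in
lemma nozero_bound {f : ℂ → ℂ} {r K : ℝ} (hr : 0 < r) (hf : DifferentiableOn ℂ f (ball 0 r))
    (hK : ∀ z ∈ ball (0:ℂ) r, ‖f z‖ ≤ K) (hne : ∀ z ∈ ball (0:ℂ) r, f z ≠ 0) :
    - (2 * Real.log (K / ‖f 0‖) / r) ≤ (deriv f 0 / f 0).re := by
  have h0m : (0:ℂ) ∈ ball (0:ℂ) r := by simpa using hr
  have h0 : f 0 ≠ 0 := hne 0 h0m
  have hf0 : 0 < ‖f 0‖ := norm_pos_iff.2 h0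
  have hK0 : ‖f 0‖ ≤ K := hK 0 h0m
  have hKp : 0 < K := hf0.trans_le hK0
  have hdiv : DifferentiableOn ℂ (fun z => deriv f z / f z) (ball 0 r) :=
    (hf.deriv isOpen_ball).div hf hne
  obtain ⟨g, hg0, hg⟩ := (hdiv.isExactOn_ball).with_val_at 0 0
  have hgd : DifferentiableOn ℂ g (ball 0 r) := fun z hz => (hg z hz).differentiableAt.differentiableWithinAt
  have hconst : ∀ z ∈ ball (0:ℂ) r, f z * exp (-g z) = f 0 := by
    intro z hz
    have := isOpen_ball.is_const_of_deriv_eq_zero (f := fun z => f z * exp (-g z)) (s := ball (0:ℂ) r)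
      (convex_ball _ _).isPreconnected (by fun_prop) (by
        intro w hw
        have hfw : HasDerivAt f (deriv f w) w := (hf.differentiableAt (isOpen_ball.mem_nhds hw)).hasDerivAt
        have := (hfw.mul ((hg w hw).neg.cexp)).deriv
        have hfw0 := hne w hw
        simp only [Pi.zero_apply]
        refine Eq.trans this ?_
        simp only [Pi.neg_apply]
        field_simp
        ring) hz h0m
    simpa [hg0] using this
  have hre : ∀ z ∈ ball (0:ℂ) r, (g z).re ≤ Real.log (K / ‖f 0‖) := by
    intro z hz
    have h1 : ‖f z‖ = ‖f 0‖ * Real.exp (g z).re := by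
      rw [← hconst z hz, norm_mul, Complex.norm_exp, neg_re, mul_assoc, ← Real.exp_add]
      simp
    rw [Real.le_log_iff_exp_le (by positivity), le_div_iff₀ hf0]
    have := hK z hz
    linarith
  have hlog : 0 ≤ Real.log (K / ‖f 0‖) := by
    apply Real.log_nonneg; rwa [le_div_iff₀ hf0, one_mul]
  have key : ∀ M : ℝ, Real.log (K / ‖f 0‖) < M → ‖deriv f 0 / f 0‖ ≤ 2 * M / r := by
    intro M hM
    have hMp : 0 < M := hlog.trans_lt hM
    have hden : ∀ z ∈ ball (0:ℂ) r, 2 * (M:ℂ) - g z ≠ 0 := by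
      intro z hz h
      have := congrArg re h
      simp at this
      linarith [hre z hz]
    have hd : DifferentiableOn ℂ (fun z => g z / (2 * M - g z)) (ball 0 r) :=
      hgd.div (hgd.const_sub _) hden
    have hb := norm_deriv_le_div_of_mapsTo_ball (f := fun z => g z / (2 * M - g z)) (c := 0) (R₁ := r) (R₂ := 1) hd (by
      intro z hz
      simp only [hg0, zero_div, mem_closedBall, dist_zero_right, norm_div]
      rw [div_le_one (norm_pos_iff.2 (hden z hz))]
      rw [← sq_le_sq₀ (by positivity) (by positivity)]
      suffices (g z).re * (g z).re ≤ (2 * M - (g z).re) * (2 * M - (g z).re) by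
        simpa [Complex.sq_norm, normSq_apply]
      nlinarith [hre z hz]) hr
    have hder : HasDerivAt (fun z => g z / (2 * (M:ℂ) - g z)) (((deriv f 0 / f 0) * (2 * M - g 0) - g 0 * (-(deriv f 0 / f 0))) / (2 * M - g 0)^2) 0 :=
      (hg 0 h0m).div ((hg 0 h0m).const_sub _) (hden 0 h0m)
    rw [hder.deriv, hg0] at hb
    have hM' : (M:ℂ) ≠ 0 := by exact_mod_cast hMp.ne'
    have e : ((deriv f 0 / f 0) * (2 * M - 0) - 0 * (-(deriv f 0 / f 0))) / (2 * (M:ℂ) - 0)^2 = (deriv f 0 / f 0) / (2 * M) := by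
      field_simp; ring
    rw [e, norm_div] at hb
    have e2 : ‖2 * (M:ℂ)‖ = 2 * M := by simp [abs_of_pos hMp]
    rw [e2, div_le_iff₀ (by positivity)] at hb
    calc _ ≤ _ := hb
      _ = _ := by ring
  have key2 : ‖deriv f 0 / f 0‖ ≤ 2 * Real.log (K / ‖f 0‖) / r := by
    apply le_of_forall_pos_le_add
    intro ε hε
    have := key (Real.log (K / ‖f 0‖) + ε * r / 2) (by have : 0 < ε * r / 2 := by positivity
                                                       linarith)
    calc _ ≤ _ := this
      _ = _ := by field_simp
  have := abs_le.1 (Complex.abs_re_le_norm (deriv f 0 / f 0))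
  linarith

open Complex Metric in
lemma manyzero_bound {r R K : ℝ} (hr : 0 < r) (hrR : r < R) (n : ℕ) : ∀ {f : ℂ → ℂ},
    DiffContOnCl ℂ f (ball 0 R) →
    (∀ z ∈ closedBall (0:ℂ) R, ‖f z‖ ≤ K) → f 0 ≠ 0 → (∀ z, ‖z‖ < R → f z = 0 → z.re ≤ 0) →
    K < ‖f 0‖ * (R / r) ^ n →
    - (2 * Real.log (K / ‖f 0‖) / r) ≤ (deriv f 0 / f 0).re := by
  have hR : 0 < R := hr.trans hrR
  induction n with
  | zero =>
    intro f hf hK h0 hz hn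
    have := hK 0 (by simp [hR.le])
    simp at hn; linarith
  | succ n ih =>
    intro f hf hK h0 hz hn
    by_cases hex : ∃ ρ, ‖ρ‖ < r ∧ f ρ = 0
    · obtain ⟨ρ, hρ, hρz⟩ := hex
      obtain ⟨h, hd, hb, hn0, hne, hzz, hder⟩ := blaschke_step hR hf hK h0 (hρ.trans hrR) hρz
      have hρ0 : ρ ≠ 0 := by rintro rfl; exact h0 hρz
      have hρp : 0 < ‖ρ‖ := norm_pos_iff.2 hρ0
      have hf0 : 0 < ‖f 0‖ := norm_pos_iff.2 h0
      have hge : ‖f 0‖ * (R / r) ≤ ‖h 0‖ := by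
        rw [hn0]; gcongr
      have h1R : 1 ≤ R / r := by rw [le_div_iff₀ hr]; linarith
      have hK0 : 0 < K := lt_of_lt_of_le hf0 (hK 0 (by simp [hR.le]))
      have hre := hz ρ (hρ.trans hrR) hρz
      have key := ih hd hb hne (by
        intro z hzR hz0
        by_cases hzρ : z = ρ
        · rw [hzρ]; exact hre
        · exact hz z hzR ((hzz z hzρ hzR).1 hz0)) (by
        calc K < ‖f 0‖ * (R/r)^(n+1) := hn
          _ = (‖f 0‖ * (R/r)) * (R/r)^n := by ring
          _ ≤ _ := by gcongr)
      have hlog : Real.log (K / ‖h 0‖) ≤ Real.log (K / ‖f 0‖) := by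
        apply Real.log_le_log
        · have := norm_pos_iff.2 hne
          positivity
        · gcongr
          nlinarith
      have hB : 0 ≤ (-1 / ρ + (starRingEnd ℂ) ρ / R ^ 2).re := by
        have e1 : (-1 / ρ + (starRingEnd ℂ) ρ / R ^ 2).re = -ρ.re * (1 / ‖ρ‖^2 - 1/R^2) := by
          have : (starRingEnd ℂ) ρ / (R:ℂ) ^ 2 = (starRingEnd ℂ) ρ * ((1 / R^2 : ℝ) : ℂ) := by
            push_cast; ring
          rw [this, add_re, re_mul_ofReal, div_re, conj_re, ← Complex.normSq_eq_norm_sq]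
          simp; ring
        rw [e1]
        apply mul_nonneg (by linarith)
        rw [sub_nonneg]
        apply one_div_le_one_div_of_le (by positivity)
        have := hρ.trans hrR
        gcongr
      rw [hder, add_re]
      have : 2 * Real.log (K / ‖h 0‖) / r ≤ 2 * Real.log (K / ‖f 0‖) / r := by gcongr
      linarith
    · push Not at hex
      apply nozero_bound hr (hf.1.mono (ball_subset_ball hrR.le))
      · intro z hz; exact hK z (ball_subset_closedBall (ball_subset_ball hrR.le hz))
      · intro z hz; exact hex z (by simpa using hz)

open Complex Metric in
lemma local_zero {r R K : ℝ} (hr : 0 < r) (hrR : r < R) (Z : Finset ℂ) : ∀ {f : ℂ → ℂ},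
    DiffContOnCl ℂ f (ball 0 R) →
    (∀ z ∈ closedBall (0:ℂ) R, ‖f z‖ ≤ K) → f 0 ≠ 0 → (∀ z, ‖z‖ < R → f z = 0 → z.re ≤ 0) →
    (∀ z ∈ Z, ‖z‖ < R ∧ f z = 0) →
    (∑ ρ ∈ Z, (-1 / ρ).re) - Z.card / R - 2 * Real.log (K / ‖f 0‖) / r ≤ (deriv f 0 / f 0).re := by
  have hR : 0 < R := hr.trans hrR
  induction Z using Finset.induction_on with
  | empty =>
    intro f hf hK h0 hz _
    have h1R : 1 < R / r := by rw [lt_div_iff₀ hr]; linarith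
    have hf0 : 0 < ‖f 0‖ := norm_pos_iff.2 h0
    obtain ⟨n, hn⟩ := pow_unbounded_of_one_lt (K / ‖f 0‖) h1R
    have := manyzero_bound hr hrR n hf hK h0 hz (by rw [div_lt_iff₀ hf0] at hn; linarith)
    simpa using this
  | insert ρ Z hnot ih =>
    intro f hf hK h0 hz hZ
    obtain ⟨hρ, hρz⟩ := hZ ρ (Finset.mem_insert_self _ _)
    obtain ⟨h, hd, hb, hn0, hne, hzz, hder⟩ := blaschke_step hR hf hK h0 hρ hρz
    have hρ0 : ρ ≠ 0 := by rintro rfl; exact h0 hρz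
    have hρp : 0 < ‖ρ‖ := norm_pos_iff.2 hρ0
    have hf0 : 0 < ‖f 0‖ := norm_pos_iff.2 h0
    have hge : ‖f 0‖ ≤ ‖h 0‖ := by
      rw [hn0]
      have : 1 ≤ R / ‖ρ‖ := by rw [le_div_iff₀ hρp]; linarith
      nlinarith
    have hK0 : 0 < K := lt_of_lt_of_le hf0 (hK 0 (by simp [hR.le]))
    have key := ih hd hb hne (by
      intro z hzR hz0
      by_cases hzρ : z = ρ
      · rw [hzρ]; exact hz ρ hρ hρz
      · exact hz z hzR ((hzz z hzρ hzR).1 hz0)) (by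
      intro z hzZ
      have h1 := hZ z (Finset.mem_insert_of_mem hzZ)
      refine ⟨h1.1, (hzz z ?_ h1.1).2 h1.2⟩
      rintro rfl; exact hnot hzZ)
    have hlog : Real.log (K / ‖h 0‖) ≤ Real.log (K / ‖f 0‖) := by
      apply Real.log_le_log
      · have := norm_pos_iff.2 hne
        positivity
      · gcongr
    have : 2 * Real.log (K / ‖h 0‖) / r ≤ 2 * Real.log (K / ‖f 0‖) / r := by gcongr
    have hB : -(1 / R) ≤ ((starRingEnd ℂ) ρ / R ^ 2).re := by
      have h1 := (abs_le.1 (Complex.abs_re_le_norm ((starRingEnd ℂ) ρ / R ^ 2))).1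
      have h2 : ‖(starRingEnd ℂ) ρ / (R:ℂ) ^ 2‖ ≤ 1 / R := by
        rw [norm_div, RCLike.norm_conj, norm_pow, Complex.norm_real, Real.norm_of_nonneg hR.le,
          div_le_div_iff₀ (by positivity) hR]
        nlinarith
      linarith
    rw [hder, add_re, add_re, Finset.sum_insert hnot, Finset.card_insert_of_notMem hnot]
    push_cast
    rw [add_div]
    linarith

open Complex Metric in
lemma local_zero' {r R K : ℝ} (hr : 0 < r) (hrR : r < R) (Z : Finset ℂ) {f : ℂ → ℂ} {s₀ : ℂ} 
    (hf : DifferentiableOn ℂ f (closedBall s₀ R))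
    (hK : ∀ z ∈ closedBall s₀ R, ‖f z‖ ≤ K) (h0 : f s₀ ≠ 0)
    (hz : ∀ z, ‖z - s₀‖ < R → f z = 0 → z.re ≤ s₀.re)
    (hZ : ∀ z ∈ Z, ‖z - s₀‖ < R ∧ f z = 0) :
    (∑ ρ ∈ Z, (1 / (s₀ - ρ)).re) - Z.card / R - 2 * Real.log (K / ‖f s₀‖) / r
      ≤ (deriv f s₀ / f s₀).re := by
  have hR : 0 < R := hr.trans hrR
  have hmt : Set.MapsTo (fun z => z + s₀) (closedBall (0:ℂ) R) (closedBall s₀ R) := by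
    intro z hz
    simpa using hz
  have hd : DifferentiableOn ℂ (fun z => f (z + s₀)) (closedBall 0 R) :=
    hf.comp (by fun_prop) hmt
  have := local_zero (K := K) hr hrR (Z.map ⟨fun z => z - s₀, sub_left_injective⟩)
    (f := fun z => f (z + s₀)) (by
      apply DifferentiableOn.diffContOnCl
      rwa [closure_ball _ hR.ne']) (by
      intro z hz; exact hK _ (hmt hz)) (by simpa using h0) (by
      intro z hzR hz0
      have := hz (z + s₀) (by simpa using hzR) hz0
      simpa using this) (by
      intro z hz
      simp only [Finset.mem_map, Function.Embedding.coeFn_mk] at hz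
      obtain ⟨w, hw, rfl⟩ := hz
      have := hZ w hw
      simpa using this)
  rw [Finset.sum_map, Finset.card_map] at this
  simp only [Function.Embedding.coeFn_mk, zero_add, deriv_comp_add_const] at this
  convert this using 4
  rename_i w _
  rw [← neg_sub w s₀, div_neg, neg_div]

open Finset in
lemma chi_sum_range {q : ℕ} [NeZero q] (χ : DirichletCharacter ℂ q) :
    ∑ k ∈ range q, χ ((k + 1 : ℕ) : ZMod q) = ∑ a : ZMod q, χ a := by
  have h1 : ∑ k ∈ range q, χ ((k + 1 : ℕ) : ZMod q) = ∑ k ∈ range q, χ (k : ZMod q) := by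
    have h2 := Finset.sum_range_succ (fun k : ℕ => χ (k : ZMod q)) q
    have h3 := Finset.sum_range_succ' (fun k : ℕ => χ (k : ZMod q)) q
    rw [h2] at h3
    simp at h3
    simpa using h3.symm
  rw [h1]
  obtain ⟨n, rfl⟩ : ∃ n, q = n + 1 := ⟨q - 1, by have := NeZero.pos q; omega⟩
  rw [← Fin.sum_univ_eq_sum_range (fun k => χ (k : ZMod (n+1)))]
  apply Fintype.sum_congr
  intro a
  congr 1
  exact Fin.cast_val_eq_self a

noncomputable def mchi {q : ℕ} [NeZero q] (χ : DirichletCharacter ℂ q) : ℂ := (∑ a : ZMod q, χ a) / q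

lemma norm_mchi {q : ℕ} [NeZero q] (χ : DirichletCharacter ℂ q) : ‖mchi χ‖ ≤ 1 := by
  rw [mchi, norm_div, Complex.norm_natCast, div_le_one (by exact_mod_cast NeZero.pos q)]
  refine (norm_sum_le _ _).trans ?_
  calc _ ≤ ∑ a : ZMod q, (1:ℝ) := Finset.sum_le_sum fun a _ => χ.norm_le_one a
    _ = q := by simp

lemma mchi_eq_zero {q : ℕ} [NeZero q] {χ : DirichletCharacter ℂ q} (h : χ ≠ 1) : mchi χ = 0 := by
  rw [mchi, MulChar.sum_eq_zero_of_ne_one h, zero_div]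

open Finset in
lemma chi_sum_bound {q : ℕ} [NeZero q] (χ : DirichletCharacter ℂ q) (N : ℕ) :
    ‖∑ k ∈ Icc 1 N, χ (k : ZMod q) - mchi χ * N‖ ≤ 2 * q := by
  have hq : (q:ℂ) ≠ 0 := by exact_mod_cast NeZero.ne q
  have e : ∀ N : ℕ, ∑ k ∈ Icc 1 N, χ (k : ZMod q) - mchi χ * N =
      ∑ k ∈ range N, (χ ((k + 1 : ℕ) : ZMod q) - mchi χ) := by
    intro N
    rw [Finset.sum_sub_distrib]
    simp only [sum_const, card_range, nsmul_eq_mul]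
    rw [mul_comm (mchi χ)]
    congr 1
    rw [Finset.range_eq_Ico, Finset.sum_Ico_add' (fun k : ℕ => χ (k : ZMod q)) 0 N 1]
    rfl
  rw [e]
  induction N using Nat.strong_induction_on with
  | _ N ih =>
    by_cases hN : N < q
    · refine (norm_sum_le _ _).trans ?_
      calc _ ≤ ∑ k ∈ range N, (2:ℝ) := by
            apply Finset.sum_le_sum
            intro k _
            refine (norm_sub_le _ _).trans ?_
            linarith [χ.norm_le_one ((k + 1 : ℕ) : ZMod q), norm_mchi χ]
        _ ≤ 2 * q := by simp; have : (N:ℝ) ≤ q := by exact_mod_cast hN.le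
                        linarith
    · obtain ⟨M, rfl⟩ : ∃ M, N = q + M := ⟨N - q, by omega⟩
      have := ih M (by have := NeZero.pos q; omega)
      rw [Finset.sum_range_add]
      have h1 : ∑ k ∈ range q, (χ ((k + 1 : ℕ) : ZMod q) - mchi χ) = 0 := by
        rw [Finset.sum_sub_distrib, chi_sum_range, mchi]
        simp
        field_simp
        simp
      rw [h1, zero_add]
      convert this using 4
      push_cast; simp

noncomputable def Schi {q : ℕ} [NeZero q] (χ : DirichletCharacter ℂ q) (t : ℝ) : ℂ :=
  ∑ k ∈ Finset.Icc 1 ⌊t⌋₊, χ (k : ZMod q)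

noncomputable def Dchi {q : ℕ} [NeZero q] (χ : DirichletCharacter ℂ q) (t : ℝ) : ℂ :=
  Schi χ t - mchi χ * t

noncomputable def Jchi {q : ℕ} [NeZero q] (χ : DirichletCharacter ℂ q) (s : ℂ) : ℂ :=
  ∫ t in Set.Ioi (1:ℝ), Dchi χ t * (t:ℂ) ^ (-(s+1))

lemma Dchi_bound {q : ℕ} [NeZero q] (χ : DirichletCharacter ℂ q) {t : ℝ} (ht : 0 ≤ t) :
    ‖Dchi χ t‖ ≤ 3 * q := by
  have h1 := chi_sum_bound χ ⌊t⌋₊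
  have e : Dchi χ t = (∑ k ∈ Finset.Icc 1 ⌊t⌋₊, χ (k : ZMod q) - mchi χ * (⌊t⌋₊:ℕ)) - mchi χ * ((t - ⌊t⌋₊ : ℝ):ℂ) := by
    rw [Dchi, Schi]; push_cast; ring
  have h2 : ‖mchi χ * ((t - ⌊t⌋₊ : ℝ):ℂ)‖ ≤ 1 := by
    rw [norm_mul, Complex.norm_real, Real.norm_of_nonneg (by linarith [Nat.floor_le ht])]
    have := Nat.lt_floor_add_one t
    have h3 := Nat.floor_le ht
    have h4 := mul_le_mul (norm_mchi χ) (show t - ⌊t⌋₊ ≤ 1 by linarith) (by linarith) zero_le_one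
    linarith
  have hq : (1:ℝ) ≤ q := by exact_mod_cast NeZero.pos q
  rw [e]
  refine (norm_sub_le _ _).trans ?_
  linarith

lemma Dchi_meas {q : ℕ} [NeZero q] (χ : DirichletCharacter ℂ q) : Measurable (Dchi χ) := by
  unfold Dchi Schi
  have : Measurable (fun n : ℕ => ∑ k ∈ Finset.Icc 1 n, χ (k : ZMod q)) := measurable_from_nat
  have h2 := this.comp (Nat.measurable_floor (R := ℝ))
  apply Measurable.sub
  · exact h2
  · fun_prop

open MeasureTheory Set in
lemma Jchi_integrable {q : ℕ} [NeZero q] (χ : DirichletCharacter ℂ q) {s : ℂ} (hs : 0 < s.re) :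
    IntegrableOn (fun t : ℝ => Dchi χ t * (t:ℂ) ^ (-(s+1))) (Ioi 1) := by
  have h1 : IntegrableOn (fun t : ℝ => (t:ℂ) ^ (-(s+1))) (Ioi 1) :=
    integrableOn_Ioi_cpow_of_lt (by simp; linarith) zero_lt_one
  refine Integrable.bdd_mul (c := 3 * q) h1 (Dchi_meas χ).aestronglyMeasurable ?_
  filter_upwards [ae_restrict_mem measurableSet_Ioi] with t ht
  exact Dchi_bound χ (by linarith [mem_Ioi.1 ht])

open MeasureTheory Set in
lemma Jchi_bound {q : ℕ} [NeZero q] (χ : DirichletCharacter ℂ q) {s : ℂ} (hs : 0 < s.re) :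
    ‖Jchi χ s‖ ≤ 3 * q / s.re := by
  have hi : IntegrableOn (fun t : ℝ => t ^ (-(s.re+1))) (Ioi 1) :=
    integrableOn_Ioi_rpow_of_lt (by linarith) zero_lt_one
  calc ‖Jchi χ s‖ ≤ ∫ t in Ioi (1:ℝ), 3 * q * t ^ (-(s.re+1)) := by
        apply norm_integral_le_of_norm_le (hi.const_mul _)
        filter_upwards [ae_restrict_mem measurableSet_Ioi] with t ht
        have ht0 : 0 < t := by linarith [mem_Ioi.1 ht]
        rw [norm_mul, Complex.norm_cpow_eq_rpow_re_of_pos ht0]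
        simp only [Complex.neg_re, Complex.add_re, Complex.one_re]
        gcongr
        exact Dchi_bound χ ht0.le
    _ = 3 * q / s.re := by
        rw [integral_const_mul, integral_Ioi_rpow_of_lt (by linarith) zero_lt_one]
        simp
        field_simp

open MeasureTheory Set Filter Asymptotics in
lemma Jchi_diff {q : ℕ} [NeZero q] (χ : DirichletCharacter ℂ q) {s : ℂ} (hs : 0 < s.re) :
    DifferentiableAt ℂ (Jchi χ) s := by
  set F : ℝ → ℂ := (Ioi (1:ℝ)).indicator (Dchi χ) with hF
  have hJ : Jchi χ = fun s => mellin F (-s) := by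
    funext s
    have : ∀ t : ℝ, (t:ℂ) ^ (-s - 1) • F t = (Ioi (1:ℝ)).indicator (fun t => Dchi χ t * (t:ℂ) ^ (-(s+1))) t := by
      intro t
      by_cases ht : t ∈ Ioi (1:ℝ)
      · simp only [hF, indicator_of_mem ht, smul_eq_mul]
        rw [mul_comm]; congr 2; ring
      · simp only [hF, indicator_of_notMem ht, smul_zero]
    unfold mellin
    simp_rw [this]
    rw [setIntegral_indicator measurableSet_Ioi, Jchi]
    congr 2
    ext t; simp
  rw [hJ]
  have hbd : ∀ t : ℝ, ‖F t‖ ≤ 3 * q := by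
    intro t
    by_cases ht : t ∈ Ioi (1:ℝ)
    · simp only [hF, indicator_of_mem ht]
      exact Dchi_bound χ (by linarith [mem_Ioi.1 ht])
    · simp only [hF, indicator_of_notMem ht, norm_zero]; positivity
  have hm : Measurable F := (Dchi_meas χ).indicator measurableSet_Ioi
  have hd : DifferentiableAt ℂ (mellin F) (-s) := by
    apply mellin_differentiableAt_of_isBigO_rpow (a := 0) (b := -s.re - 1)
    · apply LocallyIntegrable.locallyIntegrableOn
      rw [locallyIntegrable_iff]
      intro k hk
      apply Measure.integrableOn_of_bounded (M := 3 * q) hk.measure_lt_top.ne hm.aestronglyMeasurable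
      exact Eventually.of_forall hbd
    · simp only [neg_zero, Real.rpow_zero]
      exact isBigO_of_le' (c := 3 * q) _ (by simpa using hbd)
    · simpa using hs
    · have : F =ᶠ[nhdsWithin 0 (Ioi 0)] fun _ => 0 := by
        filter_upwards [mem_nhdsWithin_of_mem_nhds (Iio_mem_nhds (zero_lt_one (α := ℝ)))] with t ht
        simp only [hF]
        apply indicator_of_notMem
        simp at ht ⊢; exact ht.le
      exact this.trans_isBigO (isBigO_zero _ _)
    · simp
  exact hd.comp s (by fun_prop)

open MeasureTheory Set Filter Asymptotics in
lemma L_eq_of_one_lt {q : ℕ} [NeZero q] (χ : DirichletCharacter ℂ q) {s : ℂ} (hs : 1 < s.re) :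
    DirichletCharacter.LFunction χ s = mchi χ * (s / (s - 1)) + s * Jchi χ s := by
  rw [DirichletCharacter.LFunction_eq_LSeries χ hs]
  have hO : (fun n : ℕ ↦ ∑ k ∈ Finset.Icc 1 n, (fun n : ℕ => χ (n : ZMod q)) k) =O[atTop] fun n : ℕ ↦ (n : ℝ) ^ (1:ℝ) := by
    apply isBigO_of_le
    intro n
    refine (norm_sum_le _ _).trans ?_
    calc _ ≤ ∑ k ∈ Finset.Icc 1 n, (1:ℝ) := Finset.sum_le_sum fun k _ => χ.norm_le_one _
      _ ≤ _ := by simp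
  rw [LSeries_eq_mul_integral _ (r := 1) zero_le_one hs (DirichletCharacter.LSeriesSummable_of_one_lt_re χ hs) hO]
  have hs1 : s - 1 ≠ 0 := by
    intro h; have := congrArg Complex.re h; simp at this; linarith
  have h2 : IntegrableOn (fun t : ℝ => mchi χ * (t:ℂ) ^ (-s)) (Ioi 1) :=
    (integrableOn_Ioi_cpow_of_lt (by simpa using hs) zero_lt_one).const_mul _
  have h3 : ∫ t in Ioi (1:ℝ), (t:ℂ) ^ (-s) = 1 / (s - 1) := by
    rw [integral_Ioi_cpow_of_lt (by simpa using hs) zero_lt_one]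
    simp
    rw [show -s + 1 = -(s - 1) by ring, neg_div_neg_eq, one_div]
  have h4 : ∫ t in Ioi (1:ℝ), (∑ k ∈ Finset.Icc 1 ⌊t⌋₊, (fun n : ℕ => χ (n : ZMod q)) k) * (t:ℂ) ^ (-(s+1))
      = Jchi χ s + mchi χ * (1 / (s-1)) := by
    rw [← h3, ← integral_const_mul, Jchi, ← integral_add (Jchi_integrable χ (by linarith)) h2]
    apply setIntegral_congr_fun measurableSet_Ioi
    intro t ht
    have ht0 : 0 < t := by linarith [mem_Ioi.1 ht]
    have ht' : (t:ℂ) ≠ 0 := by exact_mod_cast ht0.ne'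
    have : (t:ℂ) ^ (-s) = t * (t:ℂ) ^ (-(s+1)) := by
      nth_rewrite 2 [← Complex.cpow_one (t:ℂ)]
      rw [← Complex.cpow_add _ _ ht']
      congr 1; ring
    simp only [Dchi, Schi, this]
    ring
  rw [h4]
  field_simp
  ring

/-- (s-1)L(s,χ) formula on the half plane. -/
lemma L_eq {q : ℕ} [NeZero q] (χ : DirichletCharacter ℂ q) {s : ℂ} (hs : 0 < s.re) (hs1 : s ≠ 1) :
    DirichletCharacter.LFunction χ s = mchi χ * (s / (s - 1)) + s * Jchi χ s := by
  set U : Set ℂ := {s | 0 < s.re} with hU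
  have hUo : IsOpen U := isOpen_lt continuous_const Complex.continuous_re
  have hUconv : Convex ℝ U := convex_halfSpace_re_gt 0
  have hV : IsPreconnected (U \ {1}) := by
    have cA : IsPreconnected {s : ℂ | 0 < s.re ∧ 0 < s.im} :=
      ((convex_halfSpace_re_gt 0).inter (convex_halfSpace_im_gt 0)).isPreconnected
    have cB : IsPreconnected {s : ℂ | 1 < s.re} := (convex_halfSpace_re_gt 1).isPreconnected
    have cC : IsPreconnected {s : ℂ | 0 < s.re ∧ s.im < 0} :=
      ((convex_halfSpace_re_gt 0).inter (convex_halfSpace_im_lt 0)).isPreconnected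
    have cD : IsPreconnected {s : ℂ | 0 < s.re ∧ s.re < 1} :=
      ((convex_halfSpace_re_gt 0).inter (convex_halfSpace_re_lt 1)).isPreconnected
    have c1 := IsPreconnected.union (2 + Complex.I) (by simp) (by simp) cA cB
    have c2 := IsPreconnected.union (2 - Complex.I) (by simp) (by simp) c1 cC
    have c3 := IsPreconnected.union (1/2 + Complex.I) (by simp) (by norm_num) c2 cD
    convert c3 using 1
    ext z
    simp only [hU, Set.mem_sdiff, Set.mem_ofPred_eq, Set.mem_singleton_iff, Set.mem_union]
    constructor
    · rintro ⟨h1, h2⟩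
      rcases lt_trichotomy z.im 0 with h | h | h
      · tauto
      · have : z.re ≠ 1 := fun h' => h2 (Complex.ext (by simpa using h') (by simpa using h))
        rcases lt_or_gt_of_ne this with h' | h' <;> tauto
      · tauto
    · rintro (((h | h) | h) | h)
      · exact ⟨h.1, by rintro rfl; simp at h⟩
      · exact ⟨by linarith, by rintro rfl; simp at h⟩
      · exact ⟨h.1, by rintro rfl; simp at h⟩
      · exact ⟨h.1, by rintro rfl; simp at h⟩
  have hVo : IsOpen (U \ {1}) := hUo.sdiff isClosed_singleton
  have h1 : AnalyticOnNhd ℂ (DirichletCharacter.LFunction χ) (U \ {1}) := by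
    apply DifferentiableOn.analyticOnNhd _ hVo
    intro z hz
    exact (DirichletCharacter.differentiableAt_LFunction χ z (Or.inl hz.2)).differentiableWithinAt
  have h2 : AnalyticOnNhd ℂ (fun s => mchi χ * (s / (s - 1)) + s * Jchi χ s) (U \ {1}) := by
    apply DifferentiableOn.analyticOnNhd _ hVo
    intro z hz
    have := Jchi_diff χ (s := z) hz.1
    have hz1 : z - 1 ≠ 0 := sub_ne_zero.2 hz.2
    apply DifferentiableAt.differentiableWithinAt
    fun_prop (disch := assumption)
  refine h1.eqOn_of_preconnected_of_eventuallyEq h2 hV (z₀ := 2) ⟨by simp [hU], by simp⟩ ?_ ⟨hs, hs1⟩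
  have : {s : ℂ | 1 < s.re} ∈ nhds (2:ℂ) := (isOpen_lt continuous_const Complex.continuous_re).mem_nhds (by simp)
  filter_upwards [this] with z hz using L_eq_of_one_lt χ hz


open Classical in
noncomputable def Gchi {q : ℕ} [NeZero q] (χ : DirichletCharacter ℂ q) (s : ℂ) : ℂ :=
  if χ = 1 then mchi χ * s + s * (s - 1) * Jchi χ s else s * Jchi χ s

lemma Gchi_eq_triv {q : ℕ} [NeZero q] {χ : DirichletCharacter ℂ q} (h : χ = 1) {s : ℂ} (hs : 0 < s.re)
    (hs1 : s ≠ 1) : Gchi χ s = (s - 1) * DirichletCharacter.LFunction χ s := by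
  rw [Gchi, if_pos h, L_eq χ hs hs1]
  have : s - 1 ≠ 0 := sub_ne_zero.2 hs1
  field_simp

lemma Gchi_eq {q : ℕ} [NeZero q] {χ : DirichletCharacter ℂ q} (h : χ ≠ 1) {s : ℂ} (hs : 0 < s.re)
    (hs1 : s ≠ 1) : Gchi χ s = DirichletCharacter.LFunction χ s := by
  rw [Gchi, if_neg h, L_eq χ hs hs1, mchi_eq_zero h]
  ring

lemma Gchi_diff {q : ℕ} [NeZero q] (χ : DirichletCharacter ℂ q) {s : ℂ} (hs : 0 < s.re) :
    DifferentiableAt ℂ (Gchi χ) s := by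
  have := Jchi_diff χ hs
  by_cases h : χ = 1
  · have e : Gchi χ = fun s => mchi χ * s + s * (s - 1) * Jchi χ s := by
      funext s; rw [Gchi, if_pos h]
    rw [e]; fun_prop
  · have e : Gchi χ = fun s => s * Jchi χ s := by
      funext s; rw [Gchi, if_neg h]
    rw [e]; fun_prop

lemma Gchi_bound {q : ℕ} [NeZero q] (χ : DirichletCharacter ℂ q) {s : ℂ} (hs : 1/2 ≤ s.re)
    {Y : ℝ} (hY : 1 ≤ Y) (h1 : ‖s‖ ≤ 2 * Y) (h2 : ‖s - 1‖ ≤ 2 * Y) :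
    ‖Gchi χ s‖ ≤ 26 * (q * Y) ^ 2 := by
  have hq : (1:ℝ) ≤ q := by exact_mod_cast NeZero.pos q
  have hJ : ‖Jchi χ s‖ ≤ 6 * q := by
    refine (Jchi_bound χ (by linarith)).trans ?_
    rw [div_le_iff₀ (by linarith)]
    nlinarith
  have hY2 : Y ≤ Y ^ 2 := by nlinarith
  have hq2 : (q:ℝ) ≤ (q:ℝ)^2 := by nlinarith
  have e1 : Y^2 * q ≤ (q*Y)^2 := by nlinarith [sq_nonneg Y]
  have e2 : Y ≤ Y^2*q := by nlinarith
  have e3 : Y * q ≤ Y^2*q := by nlinarith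
  rw [Gchi]
  split_ifs
  · refine (norm_add_le _ _).trans ?_
    rw [norm_mul, norm_mul, norm_mul]
    have a1 : ‖mchi χ‖ * ‖s‖ ≤ 1 * (2 * Y) := by gcongr; exact norm_mchi χ
    have a2 : ‖s‖ * ‖s-1‖ * ‖Jchi χ s‖ ≤ (2*Y)*(2*Y)*(6*q) := by gcongr
    nlinarith
  · rw [norm_mul]
    have a2 : ‖s‖ * ‖Jchi χ s‖ ≤ (2*Y)*(6*q) := by gcongr
    nlinarith

lemma zeta_upper {x : ℝ} (hx : 1 < x) (hx2 : x ≤ 3/2) : ‖riemannZeta x‖ ≤ 3 / (x - 1) := by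
  have h := L_eq_of_one_lt (1 : DirichletCharacter ℂ 1) (s := x) (by simpa using hx)
  rw [DirichletCharacter.LFunction_modOne_eq] at h
  have hJ := Jchi_bound (1 : DirichletCharacter ℂ 1) (s := x) (by simp; linarith)
  have hm := norm_mchi (1 : DirichletCharacter ℂ 1)
  simp at hJ
  have e1 : ‖(x:ℂ) / (x - 1)‖ = x / (x - 1) := by
    rw [show (x:ℂ)/(x-1) = ((x/(x-1) : ℝ):ℂ) by push_cast; ring, Complex.norm_real,
      Real.norm_of_nonneg (div_nonneg (by linarith) (by linarith))]
  have e2 : ‖(x:ℂ)‖ = x := by rw [Complex.norm_real, Real.norm_of_nonneg (by linarith)]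
  have hpos : 0 < x - 1 := by linarith
  have hxp : 0 < x := by linarith
  calc ‖riemannZeta x‖ ≤ ‖mchi (1 : DirichletCharacter ℂ 1)‖ * (x/(x-1)) + x * ‖Jchi (1 : DirichletCharacter ℂ 1) x‖ := by
        rw [h]; refine (norm_add_le _ _).trans ?_
        rw [norm_mul, norm_mul, e1, e2]
    _ ≤ 1 * (x/(x-1)) + x * (3/x) := by gcongr
    _ ≤ 3/(x-1) := by
        rw [show x * (3/x) = 3 by field_simp, one_mul, div_add' _ _ _ hpos.ne']
        gcongr; linarith

lemma L_lower {q : ℕ} [NeZero q] (χ : DirichletCharacter ℂ q) {s : ℂ} (h1 : 1 < s.re) (h2 : s.re ≤ 3/2) :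
    (s.re - 1) / 3 ≤ ‖DirichletCharacter.LFunction χ s‖ := by
  rw [DirichletCharacter.LFunction_eq_LSeries χ h1]
  have hmu := DirichletCharacter.LSeries.mul_mu_eq_one χ h1
  set A := LSeries (fun n : ℕ => χ (n : ZMod q)) s
  set g : ℕ → ℂ := ((fun n : ℕ => χ (n : ZMod q)) * fun n : ℕ => (ArithmeticFunction.moebius n : ℂ)) with hg
  have hz : HasSum (fun n => LSeries.term 1 (s.re:ℂ) n) (riemannZeta s.re) :=
    LSeriesHasSum_one (by simpa using h1)
  have hzs : Summable (fun n => ‖LSeries.term 1 (s.re:ℂ) n‖) := hz.summable.norm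
  have hterm : ∀ n, ‖LSeries.term g s n‖ ≤ (LSeries.term 1 (s.re:ℂ) n).re := by
    intro n
    rcases eq_or_ne n 0 with rfl | hn
    · simp
    have hn0 : (0:ℝ) < n := by exact_mod_cast Nat.pos_of_ne_zero hn
    rw [LSeries.term_of_ne_zero hn, LSeries.term_of_ne_zero hn, norm_div]
    have e : ((1 : ℕ → ℂ) n / (n:ℂ)^(s.re:ℂ)).re = 1 / (n:ℝ)^s.re := by
      have := Complex.ofReal_cpow hn0.le s.re
      push_cast at this
      rw [← this, Pi.one_apply, ← Complex.ofReal_one, ← Complex.ofReal_div, Complex.ofReal_re]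
    rw [e, Complex.norm_natCast_cpow_of_pos (Nat.pos_of_ne_zero hn)]
    gcongr
    rw [hg, Pi.mul_apply, norm_mul]
    have m1 := χ.norm_le_one (n : ZMod q)
    have m2 : ‖((ArithmeticFunction.moebius n : ℤ):ℂ)‖ ≤ 1 := by
      rw [Complex.norm_intCast]
      exact_mod_cast ArithmeticFunction.abs_moebius_le_one
    calc _ ≤ (1:ℝ) * 1 := by gcongr
      _ = 1 := one_mul 1
  have hre : HasSum (fun n => (LSeries.term 1 (s.re:ℂ) n).re) (riemannZeta s.re).re := Complex.hasSum_re hz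
  have hB : ‖LSeries g s‖ ≤ (riemannZeta s.re).re := by
    rw [LSeries]
    exact tsum_of_norm_bounded hre hterm
  have hB2 : ‖LSeries g s‖ ≤ 3/(s.re - 1) := hB.trans ((Complex.re_le_norm _).trans (zeta_upper h1 h2))
  have h3 : ‖A‖ * ‖LSeries g s‖ = 1 := by rw [← norm_mul, hmu, norm_one]
  have hp : 0 < s.re - 1 := by linarith
  rw [le_div_iff₀ hp] at hB2
  have hA : 0 ≤ ‖A‖ := norm_nonneg _
  nlinarith [mul_le_mul_of_nonneg_left hB2 hA]

lemma Gchi_lower {q : ℕ} [NeZero q] (χ : DirichletCharacter ℂ q) {s : ℂ} (h1 : 1 < s.re) (h2 : s.re ≤ 3/2) :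
    (s.re - 1)^2 / 3 ≤ ‖Gchi χ s‖ := by
  have hL := L_lower χ h1 h2
  have hs1 : s ≠ 1 := by rintro rfl; simp at h1
  have hp : 0 < s.re - 1 := by linarith
  by_cases h : χ = 1
  · rw [Gchi_eq_triv h (by linarith) hs1, norm_mul]
    have : s.re - 1 ≤ ‖s - 1‖ := by simpa using Complex.re_le_norm (s - 1)
    nlinarith [norm_nonneg (s-1)]
  · rw [Gchi_eq h (by linarith) hs1]
    nlinarith

open Metric Classical in
lemma char_local {q : ℕ} [NeZero q] (χ : DirichletCharacter ℂ q) {𝓛 t : ℝ} (h𝓛0 : Real.log 2 ≤ 𝓛)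
    (h𝓛 : Real.log (q * (|t| + 1)) ≤ 2 * 𝓛) {s₀ : ℂ} (hre : s₀.re = 1 + (1/2^20) / 𝓛) (him : s₀.im = t)
    (Z : Finset ℂ) (hcard : Z.card ≤ 2)
    (hZ : ∀ ρ ∈ Z, ‖ρ - s₀‖ < 1/2 ∧ ρ ≠ 1 ∧ DirichletCharacter.LFunction χ ρ = 0) :
    (-(deriv (DirichletCharacter.LFunction χ) s₀ / DirichletCharacter.LFunction χ s₀)).re ≤
      (if χ = 1 then (1/(s₀-1)).re else 0) - ∑ ρ ∈ Z, (1/(s₀-ρ)).re + 1000 * 𝓛 := by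
  have hl2 := Real.log_two_gt_d9
  have hL : 0 < 𝓛 := by linarith
  have hq : (1:ℝ) ≤ q := by exact_mod_cast NeZero.pos q
  have hσ1 : 1 < s₀.re := by rw [hre]; have : 0 < (1/2^20) / 𝓛 := by positivity
                             linarith
  have hσ2 : s₀.re ≤ 3/2 := by
    rw [hre]
    have : (1/2^20) / 𝓛 ≤ 1/2 := by rw [div_le_iff₀ hL]; linarith
    linarith
  have hs1 : s₀ ≠ 1 := by intro h; rw [h] at hσ1; simp at hσ1
  set Y := |t| + 1 with hYdef
  have hY : 1 ≤ Y := by have := abs_nonneg t; linarith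
  have hs0n : ‖s₀‖ ≤ 3/2 + |t| := by
    refine (Complex.norm_le_abs_re_add_abs_im s₀).trans ?_
    rw [him, abs_of_pos (by linarith)]; linarith
  have hs0n1 : ‖s₀ - 1‖ ≤ 1/2 + |t| := by
    refine (Complex.norm_le_abs_re_add_abs_im _).trans ?_
    simp only [Complex.sub_re, Complex.one_re, Complex.sub_im, Complex.one_im, sub_zero]
    rw [him, abs_of_pos (by linarith)]; linarith
  have hball : ∀ z ∈ closedBall s₀ (1/2), 1/2 ≤ z.re := by
    intro z hz
    rw [mem_closedBall, dist_eq_norm] at hz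
    have := (Complex.abs_re_le_norm (z - s₀)).trans hz
    rw [Complex.sub_re, abs_le] at this
    linarith
  have hK : ∀ z ∈ closedBall s₀ (1/2), ‖Gchi χ z‖ ≤ 26 * (q * Y)^2 := by
    intro z hz
    have hz' := hz
    rw [mem_closedBall, dist_eq_norm] at hz
    apply Gchi_bound χ (hball z hz') hY
    · calc ‖z‖ = ‖(z - s₀) + s₀‖ := by ring_nf
        _ ≤ _ := norm_add_le _ _
        _ ≤ 2 * Y := by have := abs_nonneg t; linarith
    · calc ‖z - 1‖ = ‖(z - s₀) + (s₀ - 1)‖ := by ring_nf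
        _ ≤ _ := norm_add_le _ _
        _ ≤ 2 * Y := by have := abs_nonneg t; linarith
  have hlow := Gchi_lower χ hσ1 hσ2
  have hpos : 0 < (s₀.re - 1)^2/3 := by
    have : 0 < s₀.re - 1 := by linarith
    positivity
  have hG0 : Gchi χ s₀ ≠ 0 := by rw [← norm_pos_iff]; linarith
  have main := local_zero' (r := 1/4) (R := 1/2) (K := 26 * (q*Y)^2) (by norm_num) (by norm_num) Z (f := Gchi χ) (s₀ := s₀)
    (fun z hz => (Gchi_diff χ (by linarith [hball z hz])).differentiableWithinAt) hK hG0
    (by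
      intro z hz hz0
      by_contra hlt
      push Not at hlt
      have hzre : 1 < z.re := by linarith
      have := Gchi_lower χ hzre
      have hz1 : z ≠ 1 := by intro h; rw [h] at hzre; simp at hzre
      have hne := DirichletCharacter.LFunction_ne_zero_of_one_le_re χ (s := z) (Or.inr hz1) hzre.le
      by_cases h : χ = 1
      · rw [Gchi_eq_triv h (by linarith) hz1] at hz0
        exact (mul_ne_zero (sub_ne_zero.2 hz1) hne) hz0
      · rw [Gchi_eq h (by linarith) hz1] at hz0
        exact hne hz0)
    (by
      intro z hz
      obtain ⟨h1, h2, h3⟩ := hZ z hz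
      refine ⟨h1, ?_⟩
      have : 0 < z.re := by
        have := hball z (by rw [mem_closedBall, dist_eq_norm]; exact h1.le)
        linarith
      by_cases h : χ = 1
      · rw [Gchi_eq_triv h this h2, h3, mul_zero]
      · rw [Gchi_eq h this h2, h3])
  have hlog : Real.log (26 * (q*Y)^2 / ‖Gchi χ s₀‖) ≤ 53 * 𝓛 := by
    have hle : 26 * (q*Y)^2 / ‖Gchi χ s₀‖ ≤ 2^47 * (q*Y)^2 * 𝓛^2 := by
      rw [div_le_iff₀ (by linarith)]
      have : (s₀.re - 1)^2/3 = 1/(3*2^40*𝓛^2) := by rw [hre]; field_simp; ring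
      rw [this] at hlow
      calc 26 * (q*Y)^2 ≤ 2^47 * (q*Y)^2 * 𝓛^2 * (1/(3*2^40*𝓛^2)) := by
            field_simp; norm_num
        _ ≤ _ := by gcongr
    have hqY : 0 < q * Y := by positivity
    calc _ ≤ Real.log (2^47 * (q*Y)^2 * 𝓛^2) := Real.log_le_log (by positivity) hle
      _ = 47 * Real.log 2 + 2 * Real.log (q*Y) + 2 * Real.log 𝓛 := by
          rw [Real.log_mul (by positivity) (by positivity), Real.log_mul (by positivity) (by positivity),
            Real.log_pow, Real.log_pow, Real.log_pow]; norm_num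
      _ ≤ 53 * 𝓛 := by
          have := Real.log_le_sub_one_of_pos hL
          linarith
  have hcard' : (Z.card : ℝ) ≤ 2 := by exact_mod_cast hcard
  have hder : (-(deriv (DirichletCharacter.LFunction χ) s₀ / DirichletCharacter.LFunction χ s₀)).re =
      (if χ = 1 then (1/(s₀-1)).re else 0) - (deriv (Gchi χ) s₀ / Gchi χ s₀).re := by
    have hev1 : ∀ᶠ z in nhds s₀, 0 < z.re :=
      (isOpen_lt continuous_const Complex.continuous_re).mem_nhds (show 0 < s₀.re by linarith)
    have hev : ∀ᶠ z in nhds s₀, 0 < z.re ∧ z ≠ 1 := hev1.and (isOpen_ne.mem_nhds hs1)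
    have hLne := DirichletCharacter.LFunction_ne_zero_of_one_le_re χ (s := s₀) (Or.inr hs1) hσ1.le
    by_cases h : χ = 1
    · have e : Gchi χ =ᶠ[nhds s₀] fun s => (s - 1) * DirichletCharacter.LFunction χ s := by
        filter_upwards [hev] with z hz using Gchi_eq_triv h hz.1 hz.2
      have hd := (((hasDerivAt_id s₀).sub_const 1).mul (DirichletCharacter.differentiableAt_LFunction χ s₀ (Or.inl hs1)).hasDerivAt).deriv
      rw [e.deriv_eq, Gchi_eq_triv h (by linarith) hs1, if_pos h]
      have hd' : deriv (fun s => (s - 1) * DirichletCharacter.LFunction χ s) s₀ = 1 * DirichletCharacter.LFunction χ s₀ + (s₀ - 1) * deriv (DirichletCharacter.LFunction χ) s₀ := hd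
      rw [hd', ← Complex.sub_re]
      congr 1
      have : s₀ - 1 ≠ 0 := sub_ne_zero.2 hs1
      field_simp; ring
    · have e : Gchi χ =ᶠ[nhds s₀] DirichletCharacter.LFunction χ := by
        filter_upwards [hev] with z hz using Gchi_eq h hz.1 hz.2
      rw [e.deriv_eq, Gchi_eq h (by linarith) hs1, if_neg h]
      simp
  rw [hder]
  have : 2 * Real.log (26 * (q*Y)^2 / ‖Gchi χ s₀‖) / (1/4) ≤ 424 * 𝓛 := by linarith
  linarith


noncomputable def nld {q : ℕ} [NeZero q] (χ : DirichletCharacter ℂ q) (s : ℂ) : ℂ :=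
  -(deriv (DirichletCharacter.LFunction χ) s / DirichletCharacter.LFunction χ s)

lemma nld_hasSum {q : ℕ} [NeZero q] (χ : DirichletCharacter ℂ q) {σ : ℝ} (t : ℝ) (hσ : 1 < σ) :
    HasSum (fun n : ℕ => (ArithmeticFunction.vonMangoldt n / (n:ℝ)^σ) *
      (χ (n : ZMod q) * (n:ℂ)^(-(Complex.I * t))).re) (nld χ (σ + Complex.I * t)).re := by
  have hs : 1 < ((σ:ℂ) + Complex.I * t).re := by simpa using hσ
  have h1 := (DirichletCharacter.LSeriesSummable_twist_vonMangoldt χ hs).hasSum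
  have h2 := DirichletCharacter.LSeries_twist_vonMangoldt_eq χ hs
  rw [← DirichletCharacter.deriv_LFunction_eq_deriv_LSeries χ hs,
    ← DirichletCharacter.LFunction_eq_LSeries χ hs, neg_div] at h2
  have h3 := Complex.hasSum_re h1
  rw [nld, ← h2]
  have hfun : ∀ {f g : ℕ → ℝ} {x : ℝ}, (∀ n, f n = g n) → HasSum f x → HasSum g x := by
    intro f g x h h'; rwa [← funext h]
  refine hfun ?_ h3
  intro n
  rcases eq_or_ne n 0 with rfl | hn
  · simp
  have hn0 : (0:ℝ) < n := by exact_mod_cast Nat.pos_of_ne_zero hn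
  have hnc : (n:ℂ) ≠ 0 := by exact_mod_cast hn
  rw [LSeries.term_of_ne_zero hn, Complex.cpow_add _ _ hnc, Complex.cpow_neg]
  have := Complex.ofReal_cpow hn0.le σ
  push_cast at this
  rw [← this, Pi.mul_apply]
  rw [show χ (n : ZMod q) * (ArithmeticFunction.vonMangoldt n : ℂ) / ((((n:ℝ)^σ : ℝ):ℂ) * (n:ℂ)^(Complex.I * t)) =
    ((ArithmeticFunction.vonMangoldt n / (n:ℝ)^σ : ℝ):ℂ) * (χ (n : ZMod q) * ((n:ℂ)^(Complex.I * t))⁻¹) by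
      push_cast; field_simp]
  rw [Complex.re_ofReal_mul]

lemma vM_weight_nonneg (n : ℕ) (σ : ℝ) : 0 ≤ ArithmeticFunction.vonMangoldt n / (n:ℝ)^σ :=
  div_nonneg ArithmeticFunction.vonMangoldt_nonneg (Real.rpow_nonneg (Nat.cast_nonneg n) _)

lemma pos341 {q : ℕ} [NeZero q] (χ : DirichletCharacter ℂ q) {σ : ℝ} (t : ℝ) (hσ : 1 < σ) :
    0 ≤ 3 * (nld (1 : DirichletCharacter ℂ q) σ).re + 4 * (nld χ (σ + Complex.I * t)).re
      + (nld (χ^2) (σ + Complex.I * (2 * t : ℝ))).re := by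
  have h0 := nld_hasSum (1 : DirichletCharacter ℂ q) 0 hσ
  have h1 := nld_hasSum χ t hσ
  have h2 := nld_hasSum (χ^2) (2*t) hσ
  have h := ((h0.mul_left 3).add (h1.mul_left 4)).add h2
  simp only [Complex.ofReal_zero, mul_zero, add_zero] at h
  refine h.nonneg ?_
  intro n
  rcases eq_or_ne n 0 with rfl | hn
  · simp
  have hw := vM_weight_nonneg n σ
  set w := ArithmeticFunction.vonMangoldt n / (n:ℝ)^σ
  have hnc : (n:ℂ) ≠ 0 := by exact_mod_cast hn
  by_cases hu : IsUnit (n : ZMod q)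
  · rw [MulChar.one_apply hu, MulChar.pow_apply' _ two_ne_zero]
    set z := χ (n : ZMod q) * (n:ℂ)^(-(Complex.I * t)) with hz
    have e2 : χ (n : ZMod q)^2 * (n:ℂ)^(-(Complex.I * (2*t : ℝ))) = z^2 := by
      rw [hz, mul_pow, ← Complex.cpow_nat_mul]; congr 2; push_cast; ring
    have hnz : ‖z‖ = 1 := by
      rw [hz, norm_mul, Complex.norm_natCast_cpow_of_pos (Nat.pos_of_ne_zero hn)]
      have := DirichletCharacter.unit_norm_eq_one χ hu.unit
      simpa using this
    rw [e2]
    have hn1 : z.re^2 + z.im^2 = 1 := by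
      have := Complex.sq_norm z
      rw [hnz, Complex.normSq_apply] at this; linarith
    have : (z^2).re = z.re^2 - z.im^2 := by rw [sq, Complex.mul_re]; ring
    rw [this]
    simp only [neg_zero, Complex.cpow_zero, mul_one, Complex.one_re]
    have : 0 ≤ 3 + 4 * z.re + (z.re^2 - z.im^2) := by nlinarith [sq_nonneg (z.re + 1)]
    nlinarith
  · simp [MulChar.map_nonunit _ hu]

lemma pos11 {q : ℕ} [NeZero q] (χ : DirichletCharacter ℂ q) {σ : ℝ} (hσ : 1 < σ) :
    0 ≤ (nld (1 : DirichletCharacter ℂ q) σ).re + (nld χ σ).re := by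
  have h0 := nld_hasSum (1 : DirichletCharacter ℂ q) 0 hσ
  have h1 := nld_hasSum χ 0 hσ
  have h := h0.add h1
  simp only [Complex.ofReal_zero, mul_zero, add_zero] at h
  refine h.nonneg ?_
  intro n
  have hw := vM_weight_nonneg n σ
  by_cases hu : IsUnit (n : ZMod q)
  · rw [MulChar.one_apply hu, ← mul_add]
    refine mul_nonneg hw ?_
    have := χ.norm_le_one (n : ZMod q)
    have h2 := (abs_le.1 ((Complex.abs_re_le_norm (χ (n : ZMod q))).trans this)).1
    simp only [neg_zero, Complex.cpow_zero, mul_one, Complex.one_re]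
    linarith
  · simp [MulChar.map_nonunit _ hu]

lemma quad_val {q : ℕ} {χ : DirichletCharacter ℂ q} (h : χ^2 = 1) (a : ZMod q) :
    χ a = 0 ∨ χ a = 1 ∨ χ a = -1 := by
  by_cases hu : IsUnit a
  · right
    have : (χ a)^2 = 1 := by rw [← MulChar.pow_apply' _ two_ne_zero, h, MulChar.one_apply hu]
    rcases mul_eq_zero.1 (show (χ a - 1) * (χ a + 1) = 0 by linear_combination this) with h | h
    · left; linear_combination h
    · right; linear_combination h
  · left; exact MulChar.map_nonunit _ hu

lemma pos1111 {q : ℕ} [NeZero q] {χ ψ : DirichletCharacter ℂ q} (hχ : χ^2 = 1) (hψ : ψ^2=1) {σ : ℝ} (hσ : 1 < σ) :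
    0 ≤ (nld (1 : DirichletCharacter ℂ q) σ).re + (nld χ σ).re + (nld ψ σ).re + (nld (χ * ψ) σ).re := by
  have h0 := nld_hasSum (1 : DirichletCharacter ℂ q) 0 hσ
  have h1 := nld_hasSum χ 0 hσ
  have h2 := nld_hasSum ψ 0 hσ
  have h3 := nld_hasSum (χ * ψ) 0 hσ
  have h := ((h0.add h1).add h2).add h3
  simp only [Complex.ofReal_zero, mul_zero, add_zero] at h
  refine h.nonneg ?_
  intro n
  have hw := vM_weight_nonneg n σ
  by_cases hu : IsUnit (n : ZMod q)
  · rw [MulChar.one_apply hu, ← mul_add, ← mul_add, ← mul_add]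
    refine mul_nonneg hw ?_
    rw [MulChar.mul_apply]
    simp only [neg_zero, Complex.cpow_zero, mul_one, Complex.one_re]
    rcases quad_val hχ (n : ZMod q) with a | a | a <;> rcases quad_val hψ (n : ZMod q) with b | b | b <;>
      rw [a, b] <;> norm_num
  · simp [MulChar.map_nonunit _ hu]


open Classical in
lemma nld_local {q : ℕ} [NeZero q] (χ : DirichletCharacter ℂ q) {𝓛 t u : ℝ} (h𝓛0 : Real.log 2 ≤ 𝓛)
    (h𝓛 : Real.log (q * (|t| + 1)) ≤ 2 * 𝓛) (hu : u = (1/2^20) / 𝓛)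
    (Z : Finset ℂ) (hcard : Z.card ≤ 2)
    (hZ : ∀ ρ ∈ Z, |ρ.im - t| ≤ u / 2 ∧ 1 - u / 100 ≤ ρ.re ∧ ρ.re < 1 ∧ DirichletCharacter.LFunction χ ρ = 0) :
    (nld χ ((1 + u : ℝ) + Complex.I * t)).re ≤
      (if χ = 1 then u / (u^2 + t^2) else 0) -
        ∑ ρ ∈ Z, (1 + u - ρ.re) / ((1 + u - ρ.re)^2 + (t - ρ.im)^2) + 0.001 / u := by
  have hl2 := Real.log_two_gt_d9
  have hL : 0 < 𝓛 := by linarith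
  have hu0 : 0 < u := by rw [hu]; positivity
  have hus : u < 1/1000 := by
    rw [hu, div_lt_iff₀ hL]; linarith
  have hL' : 1000 * 𝓛 ≤ 0.001 / u := by
    rw [hu]; field_simp; norm_num
  have key : ∀ x y : ℝ, (1 / ((x:ℂ) + Complex.I * y)).re = x / (x^2 + y^2) := by
    intro x y
    simp [Complex.inv_re, Complex.normSq_apply]; ring_nf
  have hloc := char_local χ h𝓛0 h𝓛 (s₀ := (1 + u : ℝ) + Complex.I * t) (by simpa using hu) (by simp) Z hcard
    (by
      intro ρ hρ
      obtain ⟨h1, h2, h3, h4⟩ := hZ ρ hρ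
      refine ⟨?_, ?_, h4⟩
      · refine (Complex.norm_le_abs_re_add_abs_im _).trans_lt ?_
        have e1 : (ρ - ((1 + u : ℝ) + Complex.I * t)).re = ρ.re - (1+u) := by simp
        have e2 : (ρ - ((1 + u : ℝ) + Complex.I * t)).im = ρ.im - t := by simp
        rw [e1, e2, abs_of_neg (by linarith)]
        linarith
      · rintro rfl; simp at h3)
  have e1 : (1 / ((((1 + u : ℝ):ℂ) + Complex.I * t) - 1)).re = u / (u^2 + t^2) := by
    rw [← key]; congr 2; push_cast; ring
  have e2 : ∀ ρ : ℂ, (1 / ((((1 + u : ℝ):ℂ) + Complex.I * t) - ρ)).re =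
      (1 + u - ρ.re) / ((1 + u - ρ.re)^2 + (t - ρ.im)^2) := by
    intro ρ
    rw [← key]; congr 2
    apply Complex.ext <;> simp
  rw [e1, Finset.sum_congr rfl (fun ρ _ => e2 ρ)] at hloc
  rw [nld]
  linarith

lemma frac_low {x y u : ℝ} (hu : 0 < u) (h1 : u ≤ x) (h2 : x ≤ 1.01 * u) (hy : |y| ≤ u / 2) :
    0.78 / u ≤ x / (x^2 + y^2) := by
  have hx : 0 < x := by linarith
  have hy2 : y^2 ≤ u^2/4 := by
    have := sq_le_sq' (by linarith [(abs_le.1 hy).1]) (abs_le.1 hy).2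
    linarith
  rw [div_le_div_iff₀ hu (by positivity)]
  nlinarith

lemma frac_real {x u : ℝ} (hu : 0 < u) (h1 : u ≤ x) (h2 : x ≤ 1.01 * u) :
    0.99 / u ≤ x / (x^2 + 0^2) := by
  have hx : 0 < x := by linarith
  rw [div_le_div_iff₀ hu (by positivity)]
  nlinarith

lemma frac_up {y u M : ℝ} (hu : 0 < u) (hM : 0 ≤ M) (h1 : M * u ≤ |y|) :
    u / (u^2 + y^2) ≤ 1 / (1 + M^2) / u := by
  have : M^2 * u^2 ≤ y^2 := by
    rw [← sq_abs y, ← mul_pow]; exact pow_le_pow_left₀ (by positivity) h1 2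
  rw [div_div, div_le_div_iff₀ (by positivity) (by positivity)]
  nlinarith

/-- at the real point, trivial character -/
lemma nld_one_le {q : ℕ} [NeZero q] {𝓛 u : ℝ} (h𝓛0 : Real.log 2 ≤ 𝓛)
    (h𝓛 : Real.log q ≤ 2 * 𝓛) (hu : u = (1/2^20) / 𝓛) :
    (nld (1 : DirichletCharacter ℂ q) (1 + u : ℝ)).re ≤ 1.001 / u := by
  classical
  have hl2 := Real.log_two_gt_d9
  have hL : 0 < 𝓛 := by linarith
  have hu0 : 0 < u := by rw [hu]; positivity
  have h := nld_local (1 : DirichletCharacter ℂ q) (t := 0) h𝓛0 (by simpa using h𝓛) hu ∅ (by simp) (by simp)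
  simp only [Complex.ofReal_zero, mul_zero, add_zero, if_true, Finset.sum_empty] at h
  refine h.trans (le_of_eq ?_)
  field_simp; ring

lemma TZ {q : ℕ} [NeZero q] {χ : DirichletCharacter ℂ q} (hχ : χ ≠ 1) {𝓛 u : ℝ} (h𝓛0 : Real.log 2 ≤ 𝓛)
    (h𝓛 : Real.log q ≤ 2 * 𝓛) (hu : u = (1/2^20) / 𝓛) {ρ₁ ρ₂ : ℂ} (hne : ρ₁ ≠ ρ₂)
    (i1 : |ρ₁.im| ≤ u / 2) (r1 : 1 - u/100 ≤ ρ₁.re) (s1 : ρ₁.re < 1) (z1 : DirichletCharacter.LFunction χ ρ₁ = 0)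
    (i2 : |ρ₂.im| ≤ u / 2) (r2 : 1 - u/100 ≤ ρ₂.re) (s2 : ρ₂.re < 1) (z2 : DirichletCharacter.LFunction χ ρ₂ = 0) :
    False := by
  classical
  have hl2 := Real.log_two_gt_d9
  have hL : 0 < 𝓛 := by linarith
  have hu0 : 0 < u := by rw [hu]; positivity
  have h1 := nld_one_le (q := q) h𝓛0 h𝓛 hu
  have h2 := nld_local χ (t := 0) h𝓛0 (by simpa using h𝓛) hu {ρ₁, ρ₂} Finset.card_le_two (by
    intro ρ hρ
    rw [Finset.mem_insert, Finset.mem_singleton] at hρ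
    rcases hρ with rfl | rfl
    · exact ⟨by simpa using i1, r1, s1, z1⟩
    · exact ⟨by simpa using i2, r2, s2, z2⟩)
  rw [Finset.sum_pair hne, if_neg hχ] at h2
  simp only [Complex.ofReal_zero, mul_zero, add_zero] at h2
  have h3 := pos11 χ (σ := 1 + u) (by linarith)
  have f1 := frac_low (x := 1 + u - ρ₁.re) (y := 0 - ρ₁.im) hu0 (by linarith) (by linarith) (by simpa using i1)
  have f2 := frac_low (x := 1 + u - ρ₂.re) (y := 0 - ρ₂.im) hu0 (by linarith) (by linarith) (by simpa using i2)
  have e : 1.001/u + (0 - (0.78/u+0.78/u) + 0.001/u) = -(0.558/u) := by ring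
  have : 0 < 0.558/u := by positivity
  linarith

lemma TC {q : ℕ} [NeZero q] {χ ψ : DirichletCharacter ℂ q} (hχ : χ ≠ 1) (hψ : ψ ≠ 1) (hχψ : χ ≠ ψ)
    (qχ : χ^2=1) (qψ : ψ^2=1) {𝓛 u : ℝ} (h𝓛0 : Real.log 2 ≤ 𝓛)
    (h𝓛 : Real.log q ≤ 2 * 𝓛) (hu : u = (1/2^20) / 𝓛) {ρ₁ ρ₂ : ℂ}
    (i1 : ρ₁.im = 0) (r1 : 1 - u/100 ≤ ρ₁.re) (s1 : ρ₁.re < 1) (z1 : DirichletCharacter.LFunction χ ρ₁ = 0)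
    (i2 : ρ₂.im = 0) (r2 : 1 - u/100 ≤ ρ₂.re) (s2 : ρ₂.re < 1) (z2 : DirichletCharacter.LFunction ψ ρ₂ = 0) :
    False := by
  classical
  have hl2 := Real.log_two_gt_d9
  have hL : 0 < 𝓛 := by linarith
  have hu0 : 0 < u := by rw [hu]; positivity
  have hprod : χ * ψ ≠ 1 := by
    intro h
    apply hχψ
    have : χ * (ψ * ψ) = ψ := by rw [← mul_assoc, h, one_mul]
    rwa [← sq, qψ, mul_one] at this
  have h1 := nld_one_le (q := q) h𝓛0 h𝓛 hu
  have h2 := nld_local χ (t := 0) h𝓛0 (by simpa using h𝓛) hu {ρ₁} (by simp) (by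
    intro ρ hρ
    rw [Finset.mem_singleton] at hρ
    subst hρ
    exact ⟨by simp [i1]; linarith, r1, s1, z1⟩)
  have h2' := nld_local ψ (t := 0) h𝓛0 (by simpa using h𝓛) hu {ρ₂} (by simp) (by
    intro ρ hρ
    rw [Finset.mem_singleton] at hρ
    subst hρ
    exact ⟨by simp [i2]; linarith, r2, s2, z2⟩)
  have h4 := nld_local (χ * ψ) (t := 0) h𝓛0 (by simpa using h𝓛) hu ∅ (by simp) (by simp)
  rw [Finset.sum_singleton, if_neg hχ, i1, sub_zero] at h2
  rw [Finset.sum_singleton, if_neg hψ, i2, sub_zero] at h2'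
  rw [if_neg hprod] at h4
  simp only [Complex.ofReal_zero, mul_zero, add_zero, Finset.sum_empty] at h2 h2' h4
  have h3 := pos1111 qχ qψ (σ := 1 + u) (by linarith)
  have f1 := frac_real (x := 1 + u - ρ₁.re) hu0 (by linarith) (by linarith)
  have f2 := frac_real (x := 1 + u - ρ₂.re) hu0 (by linarith) (by linarith)
  simp only [ne_eq, OfNat.ofNat_ne_zero, not_false_eq_true, zero_pow, add_zero] at f1 f2
  simp only [ne_eq, OfNat.ofNat_ne_zero, not_false_eq_true, zero_pow, add_zero] at h2 h2'
  have e : 1.001/u + 2 * (0 - 0.99/u + 0.001/u) + 0.001/u = -(0.976/u) := by ring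
  have : 0 < 0.976/u := by positivity
  linarith

lemma Z0 {q : ℕ} [NeZero q] {s : ℂ} (hs1 : s ≠ 1) (hs : ‖s - 1‖ < 1/6) :
    DirichletCharacter.LFunction (1 : DirichletCharacter ℂ q) s ≠ 0 := by
  have hre : 1/2 ≤ s.re := by
    have := (Complex.abs_re_le_norm (s - 1)).trans hs.le
    rw [Complex.sub_re, Complex.one_re, abs_le] at this
    linarith
  have hs0 : s ≠ 0 := by rintro rfl; simp at hre; linarith
  have h := DirichletCharacter.LFunctionTrivChar_eq_mul_riemannZeta (N := q) hs1
  rw [DirichletCharacter.LFunctionTrivChar] at h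
  rw [h]
  refine mul_ne_zero (Finset.prod_ne_zero_iff.mpr ?_) ?_
  · intro p hp h0
    have hp' := Nat.prime_of_mem_primeFactors hp
    have h2 : ‖(p:ℂ)^(-s)‖ = 1 := by rw [← sub_eq_zero.1 h0, norm_one]
    rw [Complex.norm_natCast_cpow_of_pos hp'.pos] at h2
    have : (p:ℝ)^((-s).re) < 1 := Real.rpow_lt_one_of_one_lt_of_neg (by exact_mod_cast hp'.one_lt) (by simp; linarith)
    linarith
  · have h := L_eq (1 : DirichletCharacter ℂ 1) (s := s) (by linarith) hs1
    rw [DirichletCharacter.LFunction_modOne_eq] at h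
    have hJ := Jchi_bound (1 : DirichletCharacter ℂ 1) (s := s) (by linarith)
    have hm : mchi (1 : DirichletCharacter ℂ 1) = 1 := by
      simp only [mchi, Finset.univ_unique, Finset.sum_singleton, Nat.cast_one, div_one]
      exact MulChar.one_apply (isUnit_of_subsingleton _)
    rw [hm] at h
    intro h0
    rw [h0] at h
    have hs1' : s - 1 ≠ 0 := sub_ne_zero.2 hs1
    have e : (s - 1) * Jchi (1 : DirichletCharacter ℂ 1) s = -1 := by
      field_simp at h
      have : s * (1 + (s - 1) * Jchi (1 : DirichletCharacter ℂ 1) s) = 0 := by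
        first
        | linear_combination -h
        | (rcases h with h | h
           · exact absurd h hs0
           · rw [h, mul_zero])
      rcases mul_eq_zero.1 this with h | h
      · exact absurd h hs0
      · linear_combination h
    have e2 : ‖s - 1‖ * ‖Jchi (1 : DirichletCharacter ℂ 1) s‖ = 1 := by rw [← norm_mul, e]; simp
    have hJ2 : ‖Jchi (1 : DirichletCharacter ℂ 1) s‖ ≤ 6 := by
      refine hJ.trans ?_
      rw [div_le_iff₀ (by linarith)]; push_cast; linarith
    nlinarith [norm_nonneg (s-1)]

lemma lemA {q : ℕ} [NeZero q] (hq : 2 ≤ q) {χ : DirichletCharacter ℂ q} {ρ : ℂ} {𝓛 u : ℝ}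
    (h𝓛 : 𝓛 = Real.log (q * (|ρ.im| + 1))) (hu : u = (1/2^20) / 𝓛)
    (h1 : 1 - u / 100 ≤ ρ.re) (h2 : ρ.re < 1) (hz : DirichletCharacter.LFunction χ ρ = 0) :
    χ ≠ 1 ∧ χ^2 = 1 ∧ |ρ.im| < u / 2 := by
  classical
  have hq' : (2:ℝ) ≤ q := by exact_mod_cast hq
  set t := ρ.im with ht
  have habs := abs_nonneg t
  have hlq : Real.log q ≤ 𝓛 := by
    rw [h𝓛]; apply Real.log_le_log (by linarith); nlinarith
  have h𝓛0 : Real.log 2 ≤ 𝓛 := (Real.log_le_log (by norm_num) hq').trans hlq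
  have hl2 := Real.log_two_gt_d9
  have hL : 0 < 𝓛 := by linarith
  have hu0 : 0 < u := by rw [hu]; positivity
  have hus : u < 1/1000 := by
    rw [hu, div_lt_iff₀ hL]; linarith
  have b0 : Real.log q ≤ 2 * 𝓛 := by linarith
  have b1 : Real.log (q * (|t| + 1)) ≤ 2 * 𝓛 := by linarith
  have b2 : Real.log (q * (|2 * t| + 1)) ≤ 2 * 𝓛 := by
    rw [h𝓛, show (2:ℝ) = (2:ℕ) by norm_num, ← Real.log_pow]
    apply Real.log_le_log (by positivity)
    rw [abs_mul]; simp only [Nat.cast_ofNat, abs_two]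
    nlinarith [mul_nonneg habs habs, mul_nonneg (by linarith : (0:ℝ) ≤ q) habs]
  have g0 := nld_one_le (q := q) h𝓛0 b0 hu
  have g1 := nld_local χ (t := t) h𝓛0 b1 hu {ρ} (by simp) (by
    intro ρ' hρ
    rw [Finset.mem_singleton] at hρ
    subst hρ
    exact ⟨by simp [← ht]; linarith, h1, h2, hz⟩)
  have g2 := nld_local (χ^2) (t := 2 * t) h𝓛0 b2 hu ∅ (by simp) (by simp)
  rw [Finset.sum_singleton, ← ht, sub_self] at g1
  rw [Finset.sum_empty] at g2
  have g3 := pos341 χ (σ := 1 + u) t (by linarith)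
  have f1 := frac_real (x := 1 + u - ρ.re) hu0 (by linarith) (by linarith)
  have main : 0 ≤ 4 * (if χ = 1 then u / (u^2 + t^2) else 0) + (if χ^2 = 1 then u / (u^2 + (2*t)^2) else 0)
      - 0.95/u := by
    have e : 3 * (1.001/u) + 4 * (- (0.99/u) + 0.001/u) + 0.001/u = -(0.952/u) := by ring
    have e' : 0.95/u ≤ 0.952/u := by gcongr; norm_num
    linarith
  have p95 : 0 < 0.1 / u := by positivity
  by_cases hχ : χ = 1
  · exfalso
    by_cases hbig : 10 * u ≤ |t|
    · rw [if_pos hχ, hχ, one_pow, if_pos rfl] at main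
      have k1 := frac_up (M := 10) hu0 (by norm_num) hbig
      have k2 := frac_up (M := 10) (y := 2*t) hu0 (by norm_num) (by rw [abs_mul, abs_two]; linarith)
      have : 4 * (1/(1+10^2)/u) + 1/(1+10^2)/u - 0.95/u = -((0.95 - 5/101)/u) := by ring
      have : 0 < (0.95 - 5/101)/u := by apply div_pos (by norm_num) hu0
      linarith
    · push Not at hbig
      subst hχ
      refine Z0 ?_ ?_ hz
      · rintro rfl; simp at h2
      · refine (Complex.norm_le_abs_re_add_abs_im _).trans_lt ?_
        simp only [Complex.sub_re, Complex.one_re, Complex.sub_im, Complex.one_im, sub_zero]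
        rw [← ht, abs_of_neg (by linarith)]
        linarith
  · rw [if_neg hχ] at main
    by_cases hχ2 : χ^2 = 1
    · refine ⟨hχ, hχ2, ?_⟩
      by_contra hbig
      push Not at hbig
      rw [if_pos hχ2] at main
      have k2 := frac_up (M := 1) (y := 2*t) hu0 (by norm_num) (by rw [abs_mul, abs_two]; linarith)
      have : 4 * 0 + 1/(1+1^2)/u - 0.95/u = -(0.45/u) := by ring
      have : 0 < 0.45/u := by positivity
      linarith
    · exfalso
      rw [if_neg hχ2] at main
      have : 0 < 0.95/u := by positivity
      linarith


open ComplexConjugate in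
lemma L_conj {q : ℕ} [NeZero q] {χ : DirichletCharacter ℂ q} (hq : χ^2 = 1) (hχ : χ ≠ 1) {s : ℂ} (hs : 0 < s.re)
    (hs1 : s ≠ 1) : DirichletCharacter.LFunction χ (conj s) = conj (DirichletCharacter.LFunction χ s) := by
  have hs1' : conj s ≠ 1 := by
    intro h; apply hs1
    have := congrArg conj h
    simpa using this
  rw [L_eq χ hs hs1, L_eq χ (by simpa using hs) hs1', mchi_eq_zero hχ]
  simp only [zero_mul, zero_add, map_mul]
  congr 1
  rw [Jchi, Jchi, ← integral_conj]
  refine MeasureTheory.setIntegral_congr_fun measurableSet_Ioi ?_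
  intro t ht
  have ht' : (0:ℝ) < t := by have := Set.mem_Ioi.1 ht; linarith
  simp only [map_mul]
  have e1 : conj (Dchi χ t) = Dchi χ t := by
    rw [Dchi, mchi_eq_zero hχ, zero_mul, sub_zero, Schi, map_sum]
    refine Finset.sum_congr rfl fun k _ => ?_
    rcases quad_val hq (k : ZMod q) with a | a | a <;> rw [a] <;> simp
  have e2 : conj ((t:ℂ)^(-(s+1))) = (t:ℂ)^(-(conj s+1)) := by
    have := Complex.cpow_conj (t:ℂ) (-(s+1)) (by rw [Complex.arg_ofReal_of_nonneg ht'.le]; exact Real.pi_ne_zero.symm)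
    rw [Complex.conj_ofReal] at this
    rw [← this]
    simp
  rw [e1, e2]

open ComplexConjugate in
lemma U_real {q : ℕ} [NeZero q] (hq : 2 ≤ q) {χ : DirichletCharacter ℂ q} {ρ : ℂ}
    (h1 : 1 - (1/2^20/100) / Real.log (q * (|ρ.im| + 1)) ≤ ρ.re) (h2 : ρ.re < 1)
    (hz : DirichletCharacter.LFunction χ ρ = 0) : χ ≠ 1 ∧ χ^2 = 1 ∧ ρ.im = 0 := by
  obtain ⟨u, hu⟩ : ∃ u, u = (1/2^20) / Real.log (q * (|ρ.im| + 1)) := ⟨_, rfl⟩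
  have h1' : 1 - u/100 ≤ ρ.re := by rw [hu]; convert h1 using 2; ring
  obtain ⟨a1, a2, a3⟩ := lemA hq rfl hu h1' h2 hz
  refine ⟨a1, a2, ?_⟩
  by_contra him
  have hq' : (2:ℝ) ≤ q := by exact_mod_cast hq
  have habs := abs_nonneg ρ.im
  have hlq : Real.log q ≤ Real.log (q * (|ρ.im| + 1)) := by
    apply Real.log_le_log (by linarith); nlinarith
  have h𝓛0 : Real.log 2 ≤ Real.log (q * (|ρ.im| + 1)) := (Real.log_le_log (by norm_num) hq').trans hlq
  have hl2 := Real.log_two_gt_d9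
  have hus : u < 1/1000 := by
    rw [hu, div_lt_iff₀ (by linarith)]; linarith
  have hne : ρ ≠ conj ρ := by
    intro h
    have := congrArg Complex.im h
    simp at this
    apply him; linarith
  have hρ1 : ρ ≠ 1 := by rintro rfl; simp at h2
  have hz' : DirichletCharacter.LFunction χ (conj ρ) = 0 := by
    rw [L_conj a2 a1 (by linarith) hρ1, hz, map_zero]
  exact TZ a1 h𝓛0 (by linarith) hu hne a3.le h1' h2 hz (by simpa using a3.le) (by simpa using h1') (by simpa using h2) hz'

lemma U_unique {q : ℕ} [NeZero q] (hq : 2 ≤ q) {χ ψ : DirichletCharacter ℂ q} {ρ₁ ρ₂ : ℂ}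
    (i1 : ρ₁.im = 0) (i2 : ρ₂.im = 0)
    (r1 : 1 - (1/2^20/100) / Real.log q ≤ ρ₁.re) (s1 : ρ₁.re < 1)
    (r2 : 1 - (1/2^20/100) / Real.log q ≤ ρ₂.re) (s2 : ρ₂.re < 1)
    (z1 : DirichletCharacter.LFunction χ ρ₁ = 0) (z2 : DirichletCharacter.LFunction ψ ρ₂ = 0) : ρ₁ = ρ₂ := by
  by_contra hne
  have hq' : (2:ℝ) ≤ q := by exact_mod_cast hq
  have h𝓛0 : Real.log 2 ≤ Real.log q := (Real.log_le_log (by norm_num) hq')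
  have hl2 := Real.log_two_gt_d9
  obtain ⟨a1, a2, _⟩ := U_real hq (by rw [i1]; simpa using r1) s1 z1
  obtain ⟨b1, b2, _⟩ := U_real hq (by rw [i2]; simpa using r2) s2 z2
  obtain ⟨u, hu⟩ : ∃ u, u = (1/2^20) / Real.log q := ⟨_, rfl⟩
  have hu0 : 0 < u := by rw [hu]; apply div_pos (by positivity); linarith
  have r1' : 1 - u/100 ≤ ρ₁.re := by rw [hu]; convert r1 using 2; ring
  have r2' : 1 - u/100 ≤ ρ₂.re := by rw [hu]; convert r2 using 2; ring
  by_cases h : χ = ψ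
  · subst h
    exact TZ a1 h𝓛0 (by linarith) hu hne (by rw [i1, abs_zero]; linarith) r1' s1 z1 (by rw [i2, abs_zero]; linarith) r2' s2 z2
  · exact TC a1 b1 h a2 b2 h𝓛0 (by linarith) hu i1 r1' s1 z1 i2 r2' s2 z2


open Filter Topology in
lemma T1 {q : ℕ} [NeZero q] (hq : 8 ≤ q) :
    DirichletCharacter.LFunction (1 : DirichletCharacter ℂ q) 1 ≠ 0 := by
  classical
  intro h0
  have hqpos : (0:ℝ) < q := by exact_mod_cast NeZero.pos q
  have hqc : (q:ℂ) ≠ 0 := by exact_mod_cast NeZero.ne q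
  set g : ℂ → ℂ := fun s => ∑ j : ZMod q, (1 : DirichletCharacter ℂ q) j *
    (HurwitzZeta.hurwitzZeta (ZMod.toAddCircle j) s - HurwitzZeta.hurwitzZeta 0 s) with hg
  have hgc : Continuous g := by
    refine continuous_finsetSum _ fun j _ => continuous_const.mul ?_
    exact (HurwitzZeta.differentiable_hurwitzZeta_sub_hurwitzZeta _ _).continuous
  have hsum : ∑ j : ZMod q, (1 : DirichletCharacter ℂ q) j = (q.totient : ℂ) := by
    rw [MulChar.sum_one_eq_card_units, ZMod.card_units_eq_totient]
  have hgs : ∀ s, g s = (q:ℂ)^s * DirichletCharacter.LFunction (1 : DirichletCharacter ℂ q) s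
      - q.totient * riemannZeta s := by
    intro s
    rw [hg]
    simp only [mul_sub, Finset.sum_sub_distrib]
    rw [← Finset.sum_mul, hsum, HurwitzZeta.hurwitzZeta_zero, DirichletCharacter.LFunction, ZMod.LFunction,
      ← mul_assoc, ← Complex.cpow_add _ _ hqc]
    simp
  have hg1 := hgs 1
  rw [h0, mul_zero, zero_sub] at hg1
  -- the totient as a real product
  have htot : (q.totient : ℝ) = q * ∏ p ∈ q.primeFactors, (1 - (p:ℝ)⁻¹) := by
    have := congrArg (fun x : ℚ => (x:ℝ)) (Nat.totient_eq_mul_prod_factors q)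
    push_cast at this
    exact this
  have htpos : (0:ℝ) < q.totient := by exact_mod_cast Nat.totient_pos.2 (NeZero.pos q)
  have hlim1 : Tendsto (fun x : ℝ => (g x).re) (𝓝[>] 1) (𝓝 (g 1).re) := by
    have : Continuous (fun x : ℝ => (g x).re) := by fun_prop
    have h := (this.tendsto 1).mono_left (nhdsWithin_le_nhds (s := Set.Ioi 1))
    simpa using h
  have hlim2 : Tendsto (fun x : ℝ => q.totient * (Real.log q * (((x:ℂ) - 1) * riemannZeta x).re)) (𝓝[>] 1)
      (𝓝 (q.totient * (Real.log q * 1))) := by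
    refine Tendsto.const_mul _ (Tendsto.const_mul _ ?_)
    have h1 : Tendsto (fun x : ℝ => (x:ℂ)) (𝓝[>] 1) (𝓝[≠] 1) := by
      refine tendsto_nhdsWithin_iff.2 ⟨?_, ?_⟩
      · have := (Complex.continuous_ofReal.tendsto 1).mono_left (nhdsWithin_le_nhds (s := Set.Ioi 1))
        simpa using this
      · filter_upwards [self_mem_nhdsWithin] with x hx
        have : x ≠ 1 := (Set.mem_Ioi.1 hx).ne'
        simpa using this
    have := (Complex.continuous_re.tendsto 1).comp (riemannZeta_residue_one.comp h1)
    rw [Complex.one_re] at this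
    exact this
  have hle : ∀ᶠ x : ℝ in 𝓝[>] 1, q.totient * (Real.log q * (((x:ℂ) - 1) * riemannZeta x).re) ≤ (g x).re := by
    filter_upwards [self_mem_nhdsWithin] with x hx
    have hx1 : 1 < x := hx
    have hne : (x:ℂ) ≠ 1 := by
      have : x ≠ 1 := hx1.ne'
      simpa using this
    have hz := riemannZeta_re_pos_of_one_lt hx1
    rw [hgs]
    have hL := DirichletCharacter.LFunctionTrivChar_eq_mul_riemannZeta (N := q) hne
    rw [DirichletCharacter.LFunctionTrivChar] at hL
    rw [hL]
    have e1 : (q:ℂ)^(x:ℂ) = (((q:ℝ)^x : ℝ):ℂ) := by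
      rw [Complex.ofReal_cpow hqpos.le]; simp
    have e2 : ∏ p ∈ q.primeFactors, (1 - (p:ℂ)^(-(x:ℂ))) = ((∏ p ∈ q.primeFactors, (1 - (p:ℝ)^(-x)) : ℝ):ℂ) := by
      push_cast
      refine Finset.prod_congr rfl fun p _ => ?_
      rw [Complex.ofReal_cpow (Nat.cast_nonneg p)]; simp
    rw [e1, e2]
    set P := ∏ p ∈ q.primeFactors, (1 - (p:ℝ)^(-x)) with hP
    have e3 : ((((q:ℝ)^x : ℝ):ℂ) * ((P:ℂ) * riemannZeta x) - (q.totient : ℂ) * riemannZeta x) =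
        (((q:ℝ)^x * P - q.totient : ℝ) : ℂ) * riemannZeta x := by push_cast; ring
    have e4 : ((x:ℂ) - 1) * riemannZeta x = ((x - 1 : ℝ):ℂ) * riemannZeta x := by push_cast; ring
    rw [e3, e4, Complex.re_ofReal_mul, Complex.re_ofReal_mul]
    have hPge : ∏ p ∈ q.primeFactors, (1 - (p:ℝ)⁻¹) ≤ P := by
      refine Finset.prod_le_prod ?_ ?_
      · intro p hp
        have := (Nat.prime_of_mem_primeFactors hp).one_lt
        have : (1:ℝ) ≤ p := by exact_mod_cast this.le
        have := inv_le_one_of_one_le₀ this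
        linarith
      · intro p hp
        have := (Nat.prime_of_mem_primeFactors hp).one_lt
        have hp1 : (1:ℝ) ≤ p := by exact_mod_cast this.le
        have : (p:ℝ)^(-x) ≤ (p:ℝ)^(-1:ℝ) := Real.rpow_le_rpow_of_exponent_le hp1 (by linarith)
        rw [Real.rpow_neg_one] at this
        linarith
    have hqx : (q:ℝ)^x = q * Real.exp ((x-1) * Real.log q) := by
      rw [Real.rpow_def_of_pos hqpos, show Real.log q * x = Real.log q + (x-1)*Real.log q by ring, Real.exp_add,
        Real.exp_log hqpos]
    have hexp := Real.add_one_le_exp ((x-1) * Real.log q)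
    have hfin : q.totient * (Real.log q * (x - 1)) ≤ (q:ℝ)^x * P - q.totient := by
      have : (q.totient : ℝ) * ((x-1) * Real.log q + 1) ≤ (q:ℝ)^x * P := by
        calc (q.totient : ℝ) * ((x-1) * Real.log q + 1) ≤ (q.totient : ℝ) * Real.exp ((x-1) * Real.log q) := by gcongr
          _ = (q:ℝ)^x * ∏ p ∈ q.primeFactors, (1 - (p:ℝ)⁻¹) := by rw [htot, hqx]; ring
          _ ≤ (q:ℝ)^x * P := by gcongr
      linarith
    calc _ = (q.totient * (Real.log q * (x - 1))) * (riemannZeta x).re := by ring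
      _ ≤ _ := by gcongr
  have hfinal := le_of_tendsto_of_tendsto hlim2 hlim1 hle
  rw [hg1, riemannZeta_one] at hfinal
  have e5 : (-((q.totient : ℂ) * (((Real.eulerMascheroniConstant : ℂ) - Complex.log (4 * (Real.pi:ℂ))) / 2))).re =
      -(q.totient * ((Real.eulerMascheroniConstant - Real.log (4 * Real.pi))/2)) := by
    rw [show (4 * (Real.pi:ℂ)) = ((4 * Real.pi : ℝ):ℂ) by push_cast; ring, ← Complex.ofReal_log (by positivity)]
    rw [← Complex.ofReal_re (-(q.totient * ((Real.eulerMascheroniConstant - Real.log (4 * Real.pi))/2)))]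
    push_cast; rfl
  rw [e5] at hfinal
  have hγ := Real.one_half_lt_eulerMascheroniConstant
  have h4π : Real.log (4 * Real.pi) ≤ 4 * Real.log 2 := by
    rw [show (4:ℝ) * Real.log 2 = Real.log (2^4) by rw [Real.log_pow]; norm_num]
    apply Real.log_le_log (by positivity)
    linarith [Real.pi_lt_four]
  have hlq : 3 * Real.log 2 ≤ Real.log q := by
    rw [show (3:ℝ) * Real.log 2 = Real.log (2^3) by rw [Real.log_pow]; norm_num]
    apply Real.log_le_log (by norm_num)
    have : (8:ℝ) ≤ q := by exact_mod_cast hq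
    linarith
  have hl2 := Real.log_two_gt_d9
  have : (0:ℝ) < q.totient * (Real.log q * 1 + (Real.eulerMascheroniConstant - Real.log (4 * Real.pi))/2) := by
    apply mul_pos htpos; linarith
  nlinarith


def BadZero (q : ℕ) [NeZero q] (s : ℂ) : Prop :=
  ∃ χ : DirichletCharacter ℂ q, χ ≠ 1 ∧ s.im = 0 ∧ s.re < 1 ∧
    1 - (1/2^20/100/4) / Real.log q < s.re ∧ DirichletCharacter.LFunction χ s = 0

lemma exists_badZero {q : ℕ} (hq1 : 1 < q) [NeZero q] (hq : 8 ≤ q) (h : ¬ IsGoodModulus (1/2^20/100/4) q hq1) :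
    ∃ s, BadZero q s := by
  unfold IsGoodModulus at h
  push Not at h
  obtain ⟨χ, s, h1, h2⟩ := h
  have hq' : (8:ℝ) ≤ q := by exact_mod_cast hq
  have habs := abs_nonneg s.im
  have hlog : 0 < Real.log (q * (|s.im| + 1)) := Real.log_pos (by nlinarith)
  have hre : s.re < 1 := by
    by_contra hge
    push Not at hge
    by_cases hc : χ ≠ 1 ∨ s ≠ 1
    · exact DirichletCharacter.LFunction_ne_zero_of_one_le_re χ hc hge h2
    · push Not at hc
      rw [hc.1, hc.2] at h2
      exact T1 hq h2
  have h1' : 1 - (1/2^20/100) / Real.log (q * (|s.im| + 1)) ≤ s.re := by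
    have : (1/2^20/100/4 : ℝ) / Real.log (q * (|s.im| + 1)) ≤ (1/2^20/100) / Real.log (q * (|s.im| + 1)) := by
      exact div_le_div_of_nonneg_right (by norm_num) hlog.le
    linarith
  obtain ⟨a, b, c⟩ := U_real (by omega) h1' hre h2
  refine ⟨s, χ, a, c, hre, ?_, h2⟩
  rw [c] at h1
  simpa using h1

def Pr (n : ℕ) : ℕ := ∏ p ∈ (Finset.range n).filter Nat.Prime, p

lemma Pr_pos (n : ℕ) : 0 < Pr n :=
  Finset.prod_pos fun _ hp => (Finset.mem_filter.1 hp).2.pos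

lemma Pr_dvd {m n : ℕ} (h : m ≤ n) : Pr m ∣ Pr n := by
  refine Finset.prod_dvd_prod_of_subset _ _ _ ?_
  exact Finset.filter_subset_filter _ (Finset.range_subset_range.2 h)

lemma Pr_ge {n : ℕ} (h : 10 ≤ n) : 8 ≤ Pr n := by
  have h1 : Pr 10 = 210 := by decide
  have := Nat.le_of_dvd (Pr_pos n) (Pr_dvd h)
  omega

lemma Pr_ge_half {n : ℕ} (h : 10 ≤ n) : n ≤ 2 * Pr n := by
  obtain ⟨p, hp, h1, h2⟩ := Nat.exists_prime_lt_and_le_two_mul ((n-1)/2) (by omega)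
  have hd : p ∣ Pr n := Finset.dvd_prod_of_mem (fun p => p)
    (Finset.mem_filter.2 ⟨Finset.mem_range.2 (by omega), hp⟩)
  have := Nat.le_of_dvd (Pr_pos n) hd
  omega

lemma Pr_succ_le {n : ℕ} (h : 10 ≤ n) : Pr (n+1) ≤ Pr n ^ 3 := by
  have h1 := Pr_ge_half h
  have h2 := Pr_ge h
  have h3 : Pr (n+1) ≤ n * Pr n := by
    unfold Pr
    rw [Finset.range_add_one, Finset.filter_insert]
    split_ifs
    · rw [Finset.prod_insert (by simp)]
    · exact Nat.le_mul_of_pos_left _ (by omega)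
  calc Pr (n+1) ≤ n * Pr n := h3
    _ ≤ (Pr n * Pr n) * Pr n := by
        apply Nat.mul_le_mul_right
        nlinarith
    _ = Pr n ^ 3 := by ring

/-- (Maier, Lemma 1) There is a constant `c₂ > 0` such that there exist arbitrarily large
`x` for which the modulus `P(x) = ∏_{p < x} p` is good. -/
theorem maier_good_primorial_moduli :
    ∃ c₂ > (0 : ℝ), ∀ X₀ : ℕ, ∃ x : ℕ, X₀ ≤ x ∧
      ∃ hq : 1 < ∏ p ∈ (Finset.range x).filter Nat.Prime, p,
        IsGoodModulus c₂ (∏ p ∈ (Finset.range x).filter Nat.Prime, p) hq := by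
  refine ⟨1/2^20/100/4, by norm_num, ?_⟩
  intro X₀
  suffices H : ∃ x : ℕ, X₀ ≤ x ∧ ∃ hq : 1 < Pr x, IsGoodModulus (1/2^20/100/4) (Pr x) hq from H
  by_contra hcon
  push Not at hcon
  set x0 := max X₀ 10 with hx0
  have hx10 : 10 ≤ x0 := le_max_right _ _
  have hne : ∀ n, NeZero (Pr n) := fun n => ⟨(Pr_pos n).ne'⟩
  have hbad : ∀ n, x0 ≤ n → ∃ s, BadZero (Pr n) s := by
    intro n hn
    have h8 := Pr_ge (hx10.trans hn)
    exact exists_badZero (by omega) h8 (hcon n ((le_max_left _ _).trans hn) (by omega))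
  obtain ⟨s, χ, hχ, him, hlt, hgt, hz⟩ := hbad x0 le_rfl
  have hlogpos : ∀ n, 10 ≤ n → 0 < Real.log (Pr n) := fun n hn =>
    Real.log_pos (by exact_mod_cast (by have := Pr_ge hn; omega : 1 < Pr n))
  have hδ : 0 < 1 - s.re := by linarith
  obtain ⟨B, hB⟩ : ∃ B : ℝ, B = (1/2^20/100/4) / (1 - s.re) := ⟨_, rfl⟩
  have hex : ∃ n, x0 ≤ n ∧ B ≤ Real.log (Pr n) := by
    obtain ⟨k, hk⟩ := exists_nat_ge (2 * Real.exp B)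
    refine ⟨max x0 k, le_max_left _ _, ?_⟩
    have h1 := Pr_ge_half (hx10.trans (le_max_left x0 k))
    have h2 : k ≤ 2 * Pr (max x0 k) := (le_max_right x0 k).trans h1
    have h3 : (k:ℝ) ≤ 2 * (Pr (max x0 k) : ℝ) := by exact_mod_cast h2
    rw [Real.le_log_iff_exp_le (by exact_mod_cast Pr_pos _)]
    linarith
  classical
  obtain ⟨hn1, hn2⟩ := Nat.find_spec hex
  have hmin : ∀ m, m < Nat.find hex → ¬ (x0 ≤ m ∧ B ≤ Real.log (Pr m)) := fun m hm => Nat.find_min hex hm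
  generalize Nat.find hex = n at hn1 hn2 hmin
  have hBx0 : Real.log (Pr x0) < B := by
    have := hlogpos x0 hx10
    rw [hB, lt_div_iff₀ hδ]
    have h2 : 1 - s.re < (1/2^20/100/4) / Real.log (Pr x0) := by linarith
    rw [lt_div_iff₀ this] at h2
    linarith
  have hnx : n ≠ x0 := by rintro rfl; linarith
  obtain ⟨m, rfl⟩ : ∃ m, n = m + 1 := ⟨n - 1, by omega⟩
  have hm0 : x0 ≤ m := by omega
  have hm : Real.log (Pr m) < B := by
    have := hmin m (Nat.lt_succ_self m)
    push Not at this
    exact this hm0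
  have hcube : Real.log (Pr (m+1)) ≤ 3 * Real.log (Pr m) := by
    have h1 : (Pr (m+1) : ℝ) ≤ (Pr m : ℝ)^3 := by exact_mod_cast Pr_succ_le (hx10.trans hm0)
    have h2 := Real.log_le_log (by exact_mod_cast Pr_pos _) h1
    rw [Real.log_pow] at h2
    exact_mod_cast h2
  have hlp := hlogpos (m+1) (by omega)
  -- the new zero
  obtain ⟨s', ψ, hψ, him', hlt', hgt', hz'⟩ := hbad (m+1) hn1
  have hle : s.re ≤ 1 - (1/2^20/100/4) / Real.log (Pr (m+1)) := by
    have : (1/2^20/100/4) / Real.log (Pr (m+1)) ≤ 1 - s.re := by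
      rw [hB, div_le_iff₀ hδ] at hn2
      rw [div_le_iff₀ hlp]; linarith
    linarith
  have hzz : DirichletCharacter.LFunction (DirichletCharacter.changeLevel (Pr_dvd hn1) χ) s = 0 := by
    rw [DirichletCharacter.LFunction_changeLevel (Pr_dvd hn1) χ (Or.inl hχ), hz, zero_mul]
  have hr : 1 - (1/2^20/100) / Real.log (Pr (m+1)) ≤ s.re := by
    have : 1 - s.re ≤ (1/2^20/100) / Real.log (Pr (m+1)) := by
      have h5 : Real.log (Pr (m+1)) < 3 * B := by linarith
      rw [hB, ← mul_div_assoc, lt_div_iff₀ hδ] at h5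
      rw [le_div_iff₀ hlp]
      linarith
    linarith
  have hr' : 1 - (1/2^20/100) / Real.log (Pr (m+1)) ≤ s'.re := by linarith
  have h8 := Pr_ge (n := m+1) (by omega)
  have := U_unique (by omega) him him' hr hlt hr' hlt' hzz hz'
  rw [← this] at hgt'
  linarith
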